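/- Fix ε > 0 and set k = k(n) = ⌈(1+ε)n⌉. Then p₀ = 2·log(n)/((1+ε)n) is a sharp threshold for M ~ M(n,n,k;p) to contain a Latin box: for every η > 0, if p ≤ (1−η)p₀ then the probability that M contains a Latin box tends to 0, and if p ≥ (1+η)p₀ then it tends to 1. -/

import Mathlib

attribute [local instance] Classical.propDecidable

noncomputable section

/-- The number of ones in an `m × n × k` 0-1 array. -/
def numOnes {m n k : ℕ} (M : Fin m → Fin n → Fin k → Bool) : ℕ :=
  (Finset.univ.filter (fun x : Fin m × Fin n × Fin k => M x.1 x.2.1 x.2.2 = true)).card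

/-- An `m × n × k` 0-1 array is a Latin box if it has exactly `m * n` ones and
every line (fixing two coordinates, varying the third) has at most one `1`. -/
def IsLatinBox {m n k : ℕ} (M : Fin m → Fin n → Fin k → Bool) : Prop :=
  numOnes M = m * n ∧
  (∀ i j, (Finset.univ.filter (fun c => M i j c = true)).card ≤ 1) ∧
  (∀ i c, (Finset.univ.filter (fun j => M i j c = true)).card ≤ 1) ∧
  (∀ j c, (Finset.univ.filter (fun i => M i j c = true)).card ≤ 1)

/-- `M` contains (supports) a Latin box. -/
def ContainsLatinBox {m n k : ℕ} (M : Fin m → Fin n → Fin k → Bool) : Prop :=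
  ∃ L : Fin m → Fin n → Fin k → Bool, IsLatinBox L ∧ ∀ i j c, L i j c = true → M i j c = true

/-- The probability that a random `m × n × k` 0-1 array, whose entries are
independently `1` with probability `p`, satisfies the property `P`. -/
def arrProb (m n k : ℕ) (p : ℝ) (P : (Fin m → Fin n → Fin k → Bool) → Prop) : ℝ :=
  ∑ M : Fin m → Fin n → Fin k → Bool,
    if P M then ∏ i, ∏ j, ∏ c, (if M i j c = true then p else 1 - p) else 0

/-! ### Product weights on finite function spaces -/

/-- The weight of one Bernoulli entry. -/
def bern (p : ℝ) (b : Bool) : ℝ := if b = true then p else 1 - p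

/-- The product weight of a function on a finite type. -/
def piWt {X β : Type*} [Fintype X] (w : X → β → ℝ) (S : X → β) : ℝ := ∏ x, w x (S x)

lemma bern_nonneg {p : ℝ} (hp : p ∈ Set.Icc (0 : ℝ) 1) (b : Bool) : 0 ≤ bern p b := by
  unfold bern
  split_ifs
  · exact hp.1
  · linarith [hp.2]

lemma sum_bern (p : ℝ) : ∑ b, bern p b = 1 := by
  simp [bern]

lemma piWt_nonneg {X β : Type*} [Fintype X] {w : X → β → ℝ} (hw : ∀ x b, 0 ≤ w x b)
    (S : X → β) : 0 ≤ piWt w S :=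
  Finset.prod_nonneg fun _ _ => hw _ _

lemma sum_piWt {X β : Type*} [Fintype X] [DecidableEq X] [Fintype β] (w : X → β → ℝ) :
    ∑ S, piWt w S = ∏ x, ∑ b, w x b := by
  rw [Finset.prod_univ_sum]
  simp [piWt]

lemma sum_piWt_eq_one {X β : Type*} [Fintype X] [DecidableEq X] [Fintype β] {w : X → β → ℝ}
    (hw : ∀ x, ∑ b, w x b = 1) : ∑ S, piWt w S = 1 := by
  simp [sum_piWt, hw]

lemma piWt_update {X β : Type*} [Fintype X] [DecidableEq X] (w : X → β → ℝ) (S : X → β) (x : X) (t : β) :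
    w x (S x) * piWt w (Function.update S x t) = w x t * piWt w S := by
  unfold piWt
  rw [← Finset.mul_prod_erase _ _ (Finset.mem_univ x),
    ← Finset.mul_prod_erase _ (fun y => w y (S y)) (Finset.mem_univ x)]
  have : ∏ y ∈ Finset.univ.erase x, w y (Function.update S x t y)
      = ∏ y ∈ Finset.univ.erase x, w y (S y) := by
    refine Finset.prod_congr rfl fun y hy => ?_
    rw [Function.update_of_ne (Finset.ne_of_mem_erase hy)]
  rw [this]
  simp only [Function.update_self]
  ring

/-- Resampling one coordinate of a product weight. -/
lemma sum_piWt_resample {X β : Type*} [Fintype X] [DecidableEq X] [Fintype β] (w : X → β → ℝ) (x : X)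
    (f : β → (X → β) → ℝ) (hf : ∀ t t' S, f t (Function.update S x t') = f t S) :
    (∑ t, w x t) * ∑ S, piWt w S * f (S x) S = ∑ S, piWt w S * ∑ t, w x t * f t S := by
  have e1 : (∑ t, w x t) * ∑ S, piWt w S * f (S x) S
      = ∑ z : (X → β) × β, w x z.2 * (piWt w z.1 * f (z.1 x) z.1) := by
    rw [Fintype.sum_prod_type, Finset.mul_sum]
    refine Finset.sum_congr rfl fun S _ => ?_
    rw [Finset.sum_mul]
  have e2 : ∑ S, piWt w S * ∑ t, w x t * f t S
      = ∑ z : (X → β) × β, piWt w z.1 * (w x z.2 * f z.2 z.1) := by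
    rw [Fintype.sum_prod_type]
    refine Finset.sum_congr rfl fun S _ => ?_
    rw [Finset.mul_sum]
  rw [e1, e2]
  let e : (X → β) × β → (X → β) × β := fun z => (Function.update z.1 x z.2, z.1 x)
  have he : Function.Involutive e := by
    rintro ⟨S, t⟩
    simp [e]
  refine Fintype.sum_equiv he.toPerm _ _ ?_
  rintro ⟨S, t⟩
  simp only [Function.Involutive.coe_toPerm, e, hf]
  have := piWt_update w S x t
  calc _ = (w x t * piWt w S) * f (S x) S := by ring
    _ = _ := by rw [← this]; ring

/-- Pushing a product weight forward along a map of the factors. -/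
lemma sum_piWt_comp {X β γ : Type*} [Fintype X] [DecidableEq X] [Fintype β] [Fintype γ] [DecidableEq γ]
    (w : X → β → ℝ) (π : β → γ) (F : (X → γ) → ℝ) :
    ∑ S, piWt w S * F (fun x => π (S x))
      = ∑ M, piWt (fun x c => ∑ b with π b = c, w x b) M * F M := by
  rw [← Finset.sum_fiberwise (Finset.univ : Finset (X → β)) (fun S x => π (S x))]
  refine Finset.sum_congr rfl fun M _ => ?_
  unfold piWt
  rw [Finset.prod_univ_sum, Finset.sum_mul]
  refine Finset.sum_congr ?_ ?_
  · ext S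
    simp [Fintype.mem_piFinset, funext_iff]
  · intro S hS
    simp only [Fintype.mem_piFinset, Finset.mem_filter, Finset.mem_univ, true_and] at hS
    have : (fun x => π (S x)) = M := funext hS
    rw [this]

lemma sum_piWt_bern_mono {X : Type*} [Fintype X] [DecidableEq X] {p q : ℝ} (hp : p ∈ Set.Icc (0 : ℝ) 1)
    (hq : q ∈ Set.Icc (0 : ℝ) 1) (hpq : p ≤ q) (F : (X → Bool) → ℝ)
    (hF : ∀ S T : X → Bool, (∀ x, S x = true → T x = true) → F S ≤ F T) :
    ∑ S, piWt (fun _ => bern p) S * F S ≤ ∑ S, piWt (fun _ => bern q) S * F S := by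
  obtain ⟨r, hr, hpr⟩ : ∃ r ∈ Set.Icc (0 : ℝ) 1, p = q * r := by
    rcases hq.1.eq_or_lt with h | h
    · exact ⟨0, by simp, by subst h; linarith [hp.1]⟩
    · exact ⟨p / q, ⟨div_nonneg hp.1 hq.1, (div_le_one h).2 hpq⟩, by field_simp⟩
  let w : X → Bool × Bool → ℝ := fun _ z => bern q z.1 * bern r z.2
  have h1 := sum_piWt_comp w (fun z => z.1 && z.2) F
  have h2 := sum_piWt_comp w Prod.fst F
  have e1 : (fun (x : X) (c : Bool) => ∑ z : Bool × Bool with (z.1 && z.2) = c, w x z)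
      = fun _ => bern p := by
    funext x c
    rw [Finset.sum_filter, Fintype.sum_prod_type]
    cases c
    · simp [w, bern, hpr]
      ring
    · simp [w, bern, hpr]
  have e2 : (fun (x : X) (c : Bool) => ∑ z : Bool × Bool with Prod.fst z = c, w x z)
      = fun _ => bern q := by
    funext x c
    rw [Finset.sum_filter, Fintype.sum_prod_type]
    cases c <;> · simp [w, bern]; ring
  rw [e1] at h1
  rw [e2] at h2
  rw [← h1, ← h2]
  refine Finset.sum_le_sum fun S _ => mul_le_mul_of_nonneg_left (hF _ _ ?_)
    (piWt_nonneg (fun x b => mul_nonneg (bern_nonneg hq _) (bern_nonneg hr _)) _)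
  intro x hx
  simp only [Bool.and_eq_true] at hx
  exact hx.1

/-- The moment generating function of the number of coordinates in `T` with property `B`. -/
lemma sum_piWt_exp_card_le {X β : Type*} [Fintype X] [DecidableEq X] [Fintype β] (w : X → β → ℝ)
    (hw : ∀ x b, 0 ≤ w x b) (hw1 : ∀ x, ∑ b, w x b = 1) (B : β → Prop) [DecidablePred B]
    (q : ℝ)
    (T : Finset X) (hq : ∀ x ∈ T, ∑ b with B b, w x b = q) (t : ℝ) :
    ∑ S, piWt w S * Real.exp (t * (T.filter fun x => B (S x)).card)
      ≤ Real.exp (T.card * (q * (Real.exp t - 1))) := by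
  have h : ∀ S : X → β, piWt w S * Real.exp (t * (T.filter fun x => B (S x)).card)
      = piWt (fun x b => w x b * if x ∈ T ∧ B b then Real.exp t else 1) S := by
    intro S
    unfold piWt
    rw [Finset.prod_mul_distrib]
    congr 1
    rw [Finset.prod_ite, Finset.prod_const_one, mul_one, Finset.prod_const, ← Real.exp_nat_mul,
      mul_comm]
    congr 3
    congr 1
    ext x
    simp
  rw [Finset.sum_congr rfl fun S _ => h S, sum_piWt]
  have h2 : ∀ x, ∑ b, w x b * (if x ∈ T ∧ B b then Real.exp t else 1)
      ≤ if x ∈ T then Real.exp (q * (Real.exp t - 1)) else 1 := by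
    intro x
    by_cases hx : x ∈ T
    · simp only [hx, true_and, if_true]
      have : ∑ b, w x b * (if B b then Real.exp t else 1)
          = 1 + q * (Real.exp t - 1) := by
        rw [← hq x hx, Finset.sum_filter, Finset.sum_mul,
          show (1 : ℝ) + _ = ∑ b, w x b + _ by rw [hw1 x], ← Finset.sum_add_distrib]
        refine Finset.sum_congr rfl fun b _ => ?_
        split_ifs <;> ring
      rw [this]
      linarith [Real.add_one_le_exp (q * (Real.exp t - 1))]
    · simp [hx, hw1]
  calc _ ≤ ∏ x, if x ∈ T then Real.exp (q * (Real.exp t - 1)) else 1 := by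
        refine Finset.prod_le_prod (fun x _ => Finset.sum_nonneg fun b _ => ?_) fun x _ => h2 x
        have := hw x b
        positivity
    _ = _ := by
        rw [Finset.prod_ite, Finset.prod_const_one, mul_one, Finset.prod_const,
          ← Real.exp_nat_mul]
        simp

lemma sum_bern_true (p : ℝ) : ∑ b with b = true, bern p b = p := by
  simp [Finset.sum_filter, bern]

/-- The Bernoulli weight of a list of colours. -/
def listWt {C : Type*} [Fintype C] (p : ℝ) (s : C → Bool) : ℝ := piWt (fun _ => bern p) s

lemma listWt_nonneg {C : Type*} [Fintype C] {p : ℝ} (hp : p ∈ Set.Icc (0 : ℝ) 1)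
    (s : C → Bool) : 0 ≤ listWt p s :=
  piWt_nonneg (fun _ _ => bern_nonneg hp _) _

lemma sum_listWt {C : Type*} [Fintype C] [DecidableEq C] (p : ℝ) : ∑ s : C → Bool, listWt p s = 1 :=
  sum_piWt_eq_one fun _ => sum_bern p

lemma sum_listWt_exp_card_le {C : Type*} [Fintype C] [DecidableEq C] {p : ℝ} (hp : p ∈ Set.Icc (0 : ℝ) 1)
    (T : Finset C) (t : ℝ) :
    ∑ s : C → Bool, listWt p s * Real.exp (t * (T.filter fun c => s c = true).card)
      ≤ Real.exp (T.card * (p * (Real.exp t - 1))) :=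
  sum_piWt_exp_card_le _ (fun _ _ => bern_nonneg hp _) (fun _ => sum_bern p) (· = true) p T
    (fun _ _ => sum_bern_true p) t

/-- Chernoff bound: upper tail. -/
lemma sum_piWt_card_ge_le {X β : Type*} [Fintype X] [DecidableEq X] [Fintype β] (w : X → β → ℝ)
    (hw : ∀ x b, 0 ≤ w x b) (hw1 : ∀ x, ∑ b, w x b = 1) (B : β → Prop) [DecidablePred B]
    (q : ℝ)
    (T : Finset X) (hq : ∀ x ∈ T, ∑ b with B b, w x b = q) {t : ℝ} (ht : 0 ≤ t) (m : ℝ) :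
    ∑ S, (if m ≤ (T.filter fun x => B (S x)).card then piWt w S else 0)
      ≤ Real.exp (T.card * (q * (Real.exp t - 1)) - t * m) := by
  rw [Real.exp_sub, le_div_iff₀ (Real.exp_pos _), Finset.sum_mul]
  refine le_trans (Finset.sum_le_sum fun S _ => ?_) (sum_piWt_exp_card_le w hw hw1 B q T hq t)
  have h0 := piWt_nonneg hw S
  split_ifs with h
  · gcongr
  · rw [zero_mul]
    positivity

/-- Chernoff bound: lower tail. -/
lemma sum_listWt_card_lt_le {C : Type*} [Fintype C] [DecidableEq C] {p : ℝ} (hp : p ∈ Set.Icc (0 : ℝ) 1)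
    {t : ℝ} (ht : 0 ≤ t) (m : ℝ) :
    ∑ s : C → Bool, (if ((Finset.univ.filter fun c => s c = true).card : ℝ) < m
        then listWt p s else 0)
      ≤ Real.exp (Fintype.card C * (p * (Real.exp (-t) - 1)) + t * m) := by
  have := sum_listWt_exp_card_le (C := C) hp Finset.univ (-t)
  rw [show Fintype.card C * (p * (Real.exp (-t) - 1)) + t * m
    = Finset.univ.card (α := C) * (p * (Real.exp (-t) - 1)) - (-(t * m)) by
      rw [Finset.card_univ]; ring, Real.exp_sub, le_div_iff₀ (Real.exp_pos _), Finset.sum_mul]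
  refine le_trans (Finset.sum_le_sum fun s _ => ?_) this
  have h0 := listWt_nonneg hp s
  split_ifs with h
  · refine mul_le_mul_of_nonneg_left (Real.exp_le_exp.2 ?_) h0
    nlinarith
  · rw [zero_mul]
    positivity

/-! ### Matchings in bipartite graphs, viewed as sets of cells -/

section Lines

variable {V : Type*}

/-- The cell `e` lies on the row or column `l`. -/
def onLine (l : V ⊕ V) (e : V × V) : Prop := Sum.elim (fun i => e.1 = i) (fun j => e.2 = j) l

/-- The number of cells of `U` on the line `l`. -/
def lineDeg (U : Finset (V × V)) (l : V ⊕ V) : ℕ := (U.filter (onLine l)).card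

/-- A set of cells with at most one cell on every line. -/
def IsLineMatching (N : Finset (V × V)) : Prop :=
  ∀ l, ∀ e ∈ N, ∀ e' ∈ N, onLine l e → onLine l e' → e = e'

lemma sum_onLine [Fintype V] (f : V ⊕ V → ℝ) (e : V × V) :
    ∑ l, (if onLine l e then f l else 0) = f (Sum.inl e.1) + f (Sum.inr e.2) := by
  rw [Fintype.sum_sum_type]
  congr 1
  · exact (Fintype.sum_eq_single e.1 fun x hx => if_neg fun h => hx (Eq.symm h)).trans
      (if_pos rfl)
  · exact (Fintype.sum_eq_single e.2 fun x hx => if_neg fun h => hx (Eq.symm h)).trans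
      (if_pos rfl)

lemma sum_mul_lineDeg [Fintype V] (f : V ⊕ V → ℝ) (U : Finset (V × V)) :
    ∑ l, f l * lineDeg U l = ∑ e ∈ U, (f (Sum.inl e.1) + f (Sum.inr e.2)) := by
  simp_rw [← sum_onLine]
  rw [Finset.sum_comm]
  refine Finset.sum_congr rfl fun l _ => ?_
  rw [← Finset.sum_filter, Finset.sum_const, nsmul_eq_mul, mul_comm]
  rfl

lemma lineDeg_mono {U U' : Finset (V × V)} (h : U ⊆ U') (l : V ⊕ V) :
    lineDeg U l ≤ lineDeg U' l :=
  Finset.card_le_card (Finset.filter_subset_filter _ h)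

lemma lineDeg_le_card [Fintype V] (U : Finset (V × V)) (l : V ⊕ V) : lineDeg U l ≤ Fintype.card V := by
  rcases l with i | j
  · refine (Finset.card_le_card_of_injOn Prod.snd
      (fun _ _ => Finset.mem_coe.2 (Finset.mem_univ _)) ?_).trans_eq Finset.card_univ
    intro a ha b hb hab
    simp only [onLine, Finset.coe_filter, Set.mem_ofPred_eq, Sum.elim_inl] at ha hb
    exact Prod.ext (ha.2.trans hb.2.symm) hab
  · refine (Finset.card_le_card_of_injOn Prod.fst
      (fun _ _ => Finset.mem_coe.2 (Finset.mem_univ _)) ?_).trans_eq Finset.card_univ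
    intro a ha b hb hab
    simp only [onLine, Finset.coe_filter, Set.mem_ofPred_eq, Sum.elim_inr] at ha hb
    exact Prod.ext hab (ha.2.trans hb.2.symm)

lemma IsLineMatching.lineDeg_le_one {N : Finset (V × V)} (hN : IsLineMatching N) (l : V ⊕ V) :
    lineDeg N l ≤ 1 := by
  refine Finset.card_le_one.2 fun e he e' he' => ?_
  rw [Finset.mem_filter] at he he'
  exact hN l e he.1 e' he'.1 he.2 he'.2

lemma lineDeg_sdiff [DecidableEq V] {U N : Finset (V × V)} (h : N ⊆ U) (l : V ⊕ V) :
    lineDeg (U \ N) l + lineDeg N l = lineDeg U l := by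
  unfold lineDeg
  rw [← Finset.card_union_of_disjoint, ← Finset.filter_union, Finset.sdiff_union_of_subset h]
  exact Finset.disjoint_filter_filter Finset.sdiff_disjoint

/-- A bipartite graph of maximum degree at most `d` has a matching carrying at least the
proportion `1 / d` of the total weight. -/
lemma exists_matching_weight_ge [Fintype V] (G : Finset (V × V)) {d : ℝ} (hd : 0 < d)
    (hG : ∀ l, (lineDeg G l : ℝ) ≤ d) (w : V × V → ℝ) :
    ∃ N ⊆ G, IsLineMatching N ∧ (∑ e ∈ G, w e) / d ≤ ∑ e ∈ N, w e := by
  let Y : Matrix V V ℝ := fun i j => if (i, j) ∈ G then 1 / d else 0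
  have hrow : ∀ i, ∑ j, Y i j ≤ 1 := by
    intro i
    have : ∑ j, Y i j = lineDeg G (Sum.inl i) / d := by
      simp only [Y]
      rw [← Finset.sum_filter, Finset.sum_const, nsmul_eq_mul, mul_one_div]
      congr 2
      refine Finset.card_bij (fun j _ => (i, j)) ?_ ?_ ?_
      · intro j hj
        simpa [onLine] using hj
      · intro a _ b _ h
        exact (Prod.mk.inj h).2
      · rintro ⟨a, b⟩ h
        simp only [onLine, Finset.mem_filter, Sum.elim_inl] at h
        obtain ⟨h1, rfl⟩ := h
        exact ⟨b, by simpa using h1, rfl⟩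
    rw [this, div_le_one hd]
    exact hG _
  have hcol : ∀ j, ∑ i, Y i j ≤ 1 := by
    intro j
    have : ∑ i, Y i j = lineDeg G (Sum.inr j) / d := by
      simp only [Y]
      rw [← Finset.sum_filter, Finset.sum_const, nsmul_eq_mul, mul_one_div]
      congr 2
      refine Finset.card_bij (fun i _ => (i, j)) ?_ ?_ ?_
      · intro i hi
        simpa [onLine] using hi
      · intro a _ b _ h
        exact (Prod.mk.inj h).1
      · rintro ⟨a, b⟩ h
        simp only [onLine, Finset.mem_filter, Sum.elim_inr] at h
        obtain ⟨h1, rfl⟩ := h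
        exact ⟨a, by simpa using h1, rfl⟩
    rw [this, div_le_one hd]
    exact hG _
  have hY : ∀ i j, 0 ≤ Y i j := by
    intro i j
    simp only [Y]
    split_ifs <;> positivity
  let A : Matrix (V ⊕ V) (V ⊕ V) ℝ := Matrix.fromBlocks Y
    (Matrix.diagonal fun i => 1 - ∑ j, Y i j) (Matrix.diagonal fun j => 1 - ∑ i, Y i j)
    Y.transpose
  have hA : A ∈ doublyStochastic ℝ (V ⊕ V) := by
    rw [mem_doublyStochastic_iff_sum]
    refine ⟨?_, ?_, ?_⟩
    · rintro (i | i) (j | j)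
      · exact hY i j
      · simp only [A, Matrix.fromBlocks_apply₁₂, Matrix.diagonal_apply]
        split_ifs
        · linarith [hrow i]
        · exact le_rfl
      · simp only [A, Matrix.fromBlocks_apply₂₁, Matrix.diagonal_apply]
        split_ifs
        · linarith [hcol i]
        · exact le_rfl
      · exact hY j i
    · rintro (i | i) <;> simp [A, Fintype.sum_sum_type, Matrix.diagonal_apply]
    · rintro (i | i) <;> simp [A, Fintype.sum_sum_type, Matrix.diagonal_apply]
  obtain ⟨ω, hω0, hω1, hωA⟩ := exists_eq_sum_perm_of_mem_doublyStochastic hA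
  let N : Equiv.Perm (V ⊕ V) → Finset (V × V) := fun σ =>
    G.filter fun e => σ (Sum.inl e.1) = Sum.inl e.2
  have hsum : ∑ σ, ω σ * ∑ e ∈ N σ, w e = (∑ e ∈ G, w e) / d := by
    have h1 : ∀ e ∈ G, ∑ σ, ω σ * (if σ (Sum.inl e.1) = Sum.inl e.2 then 1 else 0) = 1 / d := by
      intro e he
      have h2 : A (Sum.inl e.1) (Sum.inl e.2) = 1 / d := if_pos he
      rw [← h2, ← hωA, Matrix.sum_apply]
      refine Finset.sum_congr rfl fun σ _ => ?_
      rw [Matrix.smul_apply, Equiv.Perm.permMatrix, PEquiv.toMatrix_apply]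
      simp [Equiv.toPEquiv_apply, eq_comm]
    calc ∑ σ, ω σ * ∑ e ∈ N σ, w e
        = ∑ σ, ∑ e ∈ G, w e * (ω σ * (if σ (Sum.inl e.1) = Sum.inl e.2 then 1 else 0)) := by
          refine Finset.sum_congr rfl fun σ _ => ?_
          simp only [N]
          rw [Finset.sum_filter, Finset.mul_sum]
          refine Finset.sum_congr rfl fun e _ => ?_
          split_ifs <;> ring
      _ = ∑ e ∈ G, w e * (1 / d) := by
          rw [Finset.sum_comm]
          refine Finset.sum_congr rfl fun e he => ?_
          rw [← Finset.mul_sum, h1 e he]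
      _ = _ := by rw [← Finset.sum_mul]; ring
  obtain ⟨σ, hσ⟩ : ∃ σ, (∑ e ∈ G, w e) / d ≤ ∑ e ∈ N σ, w e := by
    by_contra! hcon
    have hle : ∀ σ ∈ Finset.univ, 0 ≤ ω σ * ((∑ e ∈ G, w e) / d - ∑ e ∈ N σ, w e) :=
      fun σ _ => mul_nonneg (hω0 σ) (by linarith [hcon σ])
    have h0 : ∑ σ, ω σ * ((∑ e ∈ G, w e) / d - ∑ e ∈ N σ, w e) = 0 := by
      simp_rw [mul_sub]
      rw [Finset.sum_sub_distrib, hsum, ← Finset.sum_mul, hω1]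
      ring
    rw [Finset.sum_eq_zero_iff_of_nonneg hle] at h0
    have : ∑ σ, ω σ = 0 := Finset.sum_eq_zero fun σ hσ => by
      rcases mul_eq_zero.1 (h0 σ hσ) with h | h
      · exact h
      · linarith [hcon σ]
    linarith
  refine ⟨N σ, Finset.filter_subset _ _, ?_, hσ⟩
  rintro (i | j) e he e' he' h h'
  · simp only [N, Finset.mem_filter] at he he'
    simp only [onLine, Sum.elim_inl] at h h'
    have : e.1 = e'.1 := h.trans h'.symm
    refine Prod.ext this ?_
    have h2 := he.2
    rw [this, he'.2] at h2
    exact (Sum.inl_injective h2).symm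
  · simp only [N, Finset.mem_filter] at he he'
    simp only [onLine, Sum.elim_inr] at h h'
    have : e.2 = e'.2 := h.trans h'.symm
    refine Prod.ext ?_ this
    have h2 := he.2
    rw [this, ← he'.2] at h2
    exact Sum.inl_injective (σ.injective h2)

/-- The exponential degree potential of a set of uncoloured cells. -/
def potential [Fintype V] (U : Finset (V × V)) : ℝ := ∑ l, (2 : ℝ) ^ lineDeg U l

/-- The weight of a cell with respect to the potential of `U`. -/
def cellWt (U : Finset (V × V)) (e : V × V) : ℝ :=
  2 ^ lineDeg U (Sum.inl e.1) + 2 ^ lineDeg U (Sum.inr e.2)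

lemma cellWt_nonneg (U : Finset (V × V)) (e : V × V) : 0 ≤ cellWt U e := by
  unfold cellWt
  positivity

lemma potential_nonneg [Fintype V] (U : Finset (V × V)) : 0 ≤ potential U :=
  Finset.sum_nonneg fun _ _ => by positivity

lemma potential_mono [Fintype V] {U U' : Finset (V × V)} (h : U ⊆ U') : potential U ≤ potential U' :=
  Finset.sum_le_sum fun l _ => pow_le_pow_right₀ (by norm_num) (lineDeg_mono h l)

lemma potential_le [Fintype V] (U : Finset (V × V)) :
    potential U ≤ 2 * Fintype.card V * 2 ^ Fintype.card V := by
  calc potential U ≤ ∑ _l : V ⊕ V, (2 : ℝ) ^ Fintype.card V :=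
        Finset.sum_le_sum fun l _ => pow_le_pow_right₀ (by norm_num) (lineDeg_le_card U l)
    _ = _ := by
        rw [Finset.sum_const, Finset.card_univ, Fintype.card_sum, nsmul_eq_mul]
        push_cast
        ring

lemma pow_lineDeg_le_potential [Fintype V] (U : Finset (V × V)) (l : V ⊕ V) :
    (2 : ℝ) ^ lineDeg U l ≤ potential U :=
  Finset.single_le_sum (f := fun l => (2 : ℝ) ^ lineDeg U l) (fun _ _ => by positivity)
    (Finset.mem_univ l)

lemma sum_cellWt [Fintype V] (U N : Finset (V × V)) :
    ∑ e ∈ N, cellWt U e = ∑ l, (2 : ℝ) ^ lineDeg U l * lineDeg N l :=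
  (sum_mul_lineDeg (fun l => (2 : ℝ) ^ lineDeg U l) N).symm

lemma potential_sdiff [Fintype V] [DecidableEq V] {U N : Finset (V × V)} (h : N ⊆ U) (hN : IsLineMatching N) :
    potential (U \ N) = potential U - (∑ e ∈ N, cellWt U e) / 2 := by
  rw [sum_cellWt]
  unfold potential
  rw [Finset.sum_div, ← Finset.sum_sub_distrib]
  refine Finset.sum_congr rfl fun l _ => ?_
  have h1 := lineDeg_sdiff h l
  have h2 := hN.lineDeg_le_one l
  rw [← h1]
  interval_cases lineDeg N l
  · simp
  · rw [pow_succ]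
    push_cast
    ring

/-- A matching inside `G` of maximum weight with respect to the potential of `U`. -/
lemma exists_max_matching (U G : Finset (V × V)) :
    ∃ N ⊆ G, IsLineMatching N ∧
      ∀ N' ⊆ G, IsLineMatching N' → ∑ e ∈ N', cellWt U e ≤ ∑ e ∈ N, cellWt U e := by
  obtain ⟨N, hN, hmax⟩ := Finset.exists_max_image (G.powerset.filter IsLineMatching)
    (fun N => ∑ e ∈ N, cellWt U e)
    ⟨∅, by simp [IsLineMatching]⟩
  simp only [Finset.mem_filter, Finset.mem_powerset] at hN hmax
  exact ⟨N, hN.1, hN.2, fun N' h₁ h₂ => hmax N' ⟨h₁, h₂⟩⟩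

/-- The chosen maximum weight matching. -/
def pickMatching (U G : Finset (V × V)) : Finset (V × V) := (exists_max_matching U G).choose

lemma pickMatching_subset (U G : Finset (V × V)) : pickMatching U G ⊆ G :=
  (exists_max_matching U G).choose_spec.1

lemma isLineMatching_pickMatching (U G : Finset (V × V)) : IsLineMatching (pickMatching U G) :=
  (exists_max_matching U G).choose_spec.2.1

lemma sum_cellWt_le_pickMatching (U : Finset (V × V)) {G N : Finset (V × V)} (h : N ⊆ G)
    (hN : IsLineMatching N) : ∑ e ∈ N, cellWt U e ≤ ∑ e ∈ pickMatching U G, cellWt U e :=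
  (exists_max_matching U G).choose_spec.2.2 N h hN

/-- The edges of `G` all of whose lines have degree at most `d` in `G`. -/
def trimmed (G : Finset (V × V)) (d : ℝ) : Finset (V × V) :=
  G.filter fun e => ∀ l, onLine l e → (lineDeg G l : ℝ) ≤ d

lemma mem_trimmed {G : Finset (V × V)} {d : ℝ} {e : V × V} :
    e ∈ trimmed G d ↔ e ∈ G ∧ ∀ l, onLine l e → (lineDeg G l : ℝ) ≤ d := by
  simp [trimmed]

lemma trimmed_subset (G : Finset (V × V)) (d : ℝ) : trimmed G d ⊆ G :=
  fun _ he => (mem_trimmed.1 he).1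

lemma potential_sdiff_pickMatching_le [Fintype V] [DecidableEq V]
    {U G : Finset (V × V)} (h : G ⊆ U) {d : ℝ} (hd : 0 < d) :
    potential (U \ pickMatching U G)
      ≤ potential U - (∑ e ∈ trimmed G d, cellWt U e) / (2 * d) := by
  rw [potential_sdiff ((pickMatching_subset U G).trans h) (isLineMatching_pickMatching U G)]
  obtain ⟨N, hN, hNm, hNw⟩ := exists_matching_weight_ge (trimmed G d) hd (fun l => by
    by_cases hl : ∃ e ∈ trimmed G d, onLine l e
    · obtain ⟨e, he, hel⟩ := hl
      refine le_trans ?_ ((mem_trimmed.1 he).2 l hel)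
      exact_mod_cast lineDeg_mono (trimmed_subset _ _) l
    · push Not at hl
      rw [lineDeg, Finset.filter_false_of_mem hl]
      simpa using hd.le) (cellWt U)
  have := sum_cellWt_le_pickMatching U (hN.trans (trimmed_subset _ _)) hNm
  rw [mul_comm 2 d, ← div_div]
  linarith

end Lines

/-! ### One step of the matching process -/

section Step

variable {V : Type*}

lemma sum_piWt_bern_apply {X : Type*} [Fintype X] [DecidableEq X] (p : ℝ) (x : X) :
    ∑ m : X → Bool, piWt (fun _ => bern p) m * (if m x = true then 1 else 0) = p := by
  have h := sum_piWt_resample (fun _ : X => bern p) x (fun b _ => if b = true then 1 else 0)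
    (fun _ _ _ => rfl)
  rw [sum_bern, one_mul] at h
  rw [h, ← Finset.sum_mul, sum_piWt_eq_one fun _ => sum_bern p]
  simp [bern]

lemma sum_piWt_lineDeg_gt_le [Fintype V] [DecidableEq V] {p : ℝ} (hp : p ∈ Set.Icc (0 : ℝ) 1)
    {U : Finset (V × V)} {e : V × V} (he : e ∈ U) {l : V ⊕ V} (hl : onLine l e)
    {t : ℝ} (ht : 0 ≤ t) (d : ℝ) :
    ∑ m : V × V → Bool, piWt (fun _ => bern p) m *
        (if m e = true ∧ d < lineDeg (U.filter fun x => m x = true) l then 1 else 0)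
      ≤ p * Real.exp (t - t * d + lineDeg U l * (p * (Real.exp t - 1))) := by
  let T := (U.filter (onLine l)).erase e
  let f : Bool → (V × V → Bool) → ℝ := fun b m => if b = true then
    Real.exp (t - t * d) * Real.exp (t * (T.filter fun x => m x = true).card) else 0
  have hf : ∀ b b' m, f b (Function.update m e b') = f b m := by
    intro b b' m
    simp only [f]
    have : (T.filter fun x => Function.update m e b' x = true)
        = T.filter fun x => m x = true := by
      refine Finset.filter_congr fun x hx => ?_
      rw [Function.update_of_ne (Finset.ne_of_mem_erase hx)]
    rw [this]
  have hres := sum_piWt_resample (fun _ : V × V => bern p) e f hf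
  rw [sum_bern, one_mul] at hres
  have hle : ∀ m : V × V → Bool,
      (if m e = true ∧ d < lineDeg (U.filter fun x => m x = true) l then (1 : ℝ) else 0)
        ≤ f (m e) m := by
    intro m
    split_ifs with h
    · simp only [f, h.1, if_true]
      rw [← Real.exp_add]
      refine Real.one_le_exp ?_
      have hcard : lineDeg (U.filter fun x => m x = true) l
          = (T.filter fun x => m x = true).card + 1 := by
        rw [lineDeg, Finset.filter_filter, ← Finset.card_erase_add_one (a := e)
          (by simp [he, h.1, hl])]
        congr 2
        ext x
        simp only [T, Finset.mem_erase, Finset.mem_filter]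
        tauto
      have h2 := h.2
      rw [hcard] at h2
      push_cast at h2
      nlinarith
    · simp only [f]
      split_ifs <;> positivity
  calc _ ≤ ∑ m, piWt (fun _ => bern p) m * f (m e) m :=
        Finset.sum_le_sum fun m _ => mul_le_mul_of_nonneg_left (hle m)
          (piWt_nonneg (fun _ _ => bern_nonneg hp _) _)
    _ = ∑ m, piWt (fun _ => bern p) m * ∑ b, bern p b * f b m := hres
    _ = p * Real.exp (t - t * d) * ∑ m : V × V → Bool, piWt (fun _ => bern p) m *
          Real.exp (t * (T.filter fun x => m x = true).card) := by
        rw [Finset.mul_sum]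
        refine Finset.sum_congr rfl fun m _ => ?_
        simp [f, bern]
        ring
    _ ≤ p * Real.exp (t - t * d) * Real.exp (T.card * (p * (Real.exp t - 1))) := by
        refine mul_le_mul_of_nonneg_left ?_ (mul_nonneg hp.1 (Real.exp_pos _).le)
        exact sum_piWt_exp_card_le _ (fun _ _ => bern_nonneg hp _) (fun _ => sum_bern p)
          (· = true) p T (fun _ _ => sum_bern_true p) t
    _ ≤ _ := by
        rw [mul_assoc, ← Real.exp_add]
        refine mul_le_mul_of_nonneg_left (Real.exp_le_exp.2 ?_) hp.1
        have h1 : (T.card : ℝ) ≤ lineDeg U l := by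
          exact_mod_cast Finset.card_le_card (Finset.erase_subset _ _)
        have h2 : 0 ≤ p * (Real.exp t - 1) :=
          mul_nonneg hp.1 (by linarith [Real.one_le_exp ht])
        nlinarith

/-- A cell of `U` survives in the trimmed random subgraph with probability close to `p`. -/
lemma le_sum_piWt_mem_trimmed [Fintype V] [DecidableEq V] {p : ℝ} (hp : p ∈ Set.Icc (0 : ℝ) 1)
    {U : Finset (V × V)} {e : V × V} (he : e ∈ U)
    {t : ℝ} (ht : 0 ≤ t) (d D : ℝ) (hD : ∀ l, (lineDeg U l : ℝ) ≤ D) {κ : ℝ}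
    (hκ : Real.exp (t - t * d + D * (p * (Real.exp t - 1))) ≤ κ) :
    p * (1 - 2 * κ) ≤ ∑ m : V × V → Bool, piWt (fun _ => bern p) m *
        (if e ∈ trimmed (U.filter fun x => m x = true) d then 1 else 0) := by
  have hb : ∀ l, onLine l e → ∑ m : V × V → Bool, piWt (fun _ => bern p) m *
        (if m e = true ∧ d < lineDeg (U.filter fun x => m x = true) l then 1 else 0)
      ≤ p * κ := by
    intro l hl
    refine (sum_piWt_lineDeg_gt_le hp he hl ht d).trans
      (mul_le_mul_of_nonneg_left (le_trans (Real.exp_le_exp.2 ?_) hκ) hp.1)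
    have h2 : 0 ≤ p * (Real.exp t - 1) :=
      mul_nonneg hp.1 (by linarith [Real.one_le_exp ht])
    nlinarith [hD l]
  have h1 := hb (Sum.inl e.1) rfl
  have h2 := hb (Sum.inr e.2) rfl
  have h0 := sum_piWt_bern_apply p e
  have hpt : ∀ m : V × V → Bool, (if m e = true then (1 : ℝ) else 0)
      ≤ (if e ∈ trimmed (U.filter fun x => m x = true) d then 1 else 0)
        + (if m e = true ∧ d < lineDeg (U.filter fun x => m x = true) (Sum.inl e.1)
            then 1 else 0)
        + (if m e = true ∧ d < lineDeg (U.filter fun x => m x = true) (Sum.inr e.2)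
            then 1 else 0) := by
    intro m
    by_cases hm : m e = true
    · by_cases ha : d < lineDeg (U.filter fun x => m x = true) (Sum.inl e.1)
      · rw [if_pos hm, if_pos (c := _ ∧ d < (lineDeg _ (Sum.inl e.1) : ℝ)) ⟨hm, ha⟩]
        split_ifs <;> norm_num
      · by_cases hb : d < lineDeg (U.filter fun x => m x = true) (Sum.inr e.2)
        · rw [if_pos hm, if_pos (c := _ ∧ d < (lineDeg _ (Sum.inr e.2) : ℝ)) ⟨hm, hb⟩]
          split_ifs <;> norm_num
        · have : e ∈ trimmed (U.filter fun x => m x = true) d := by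
            rw [mem_trimmed, Finset.mem_filter]
            refine ⟨⟨he, hm⟩, ?_⟩
            rintro (i | j) h
            · simp only [onLine, Sum.elim_inl] at h
              subst h
              exact not_lt.1 ha
            · simp only [onLine, Sum.elim_inr] at h
              subst h
              exact not_lt.1 hb
          rw [if_pos hm, if_pos this]
          split_ifs <;> norm_num
    · rw [if_neg hm]
      split_ifs <;> norm_num
  have := Finset.sum_le_sum fun (m : V × V → Bool) (_ : m ∈ Finset.univ) =>
    mul_le_mul_of_nonneg_left (hpt m)
      (piWt_nonneg (w := fun _ => bern p) (fun _ _ => bern_nonneg hp _) m)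
  simp only [mul_add, Finset.sum_add_distrib] at this
  linarith

/-- One step of the process decreases the expected potential by a factor close to `1 / 2`. -/
lemma sum_piWt_potential_step_le [Fintype V] [DecidableEq V] {p : ℝ} (hp : p ∈ Set.Icc (0 : ℝ) 1) (hp0 : 0 < p)
    (U : Finset (V × V)) {t ξ D : ℝ} (ht : 0 ≤ t) (hξ : 0 < ξ) (hξ1 : ξ ≤ 1 / 2) (hD0 : 0 < D)
    (hD : (2 : ℝ) ^ D = potential U)
    (h1 : Real.exp (t - t * ((1 + ξ) * D * p) + D * (p * (Real.exp t - 1))) ≤ ξ)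
    (h2 : 2 * Fintype.card V * (2 : ℝ) ^ ((1 - ξ) * D) ≤ ξ * 2 ^ D) :
    ∑ m : V × V → Bool, piWt (fun _ => bern p) m *
        potential (U \ pickMatching U (U.filter fun x => m x = true))
      ≤ (1 - (1 - 2 * ξ) * (1 - ξ) ^ 2 / (2 * (1 + ξ))) * potential U := by
  have hdeg : ∀ l, (lineDeg U l : ℝ) ≤ D := by
    intro l
    have := pow_lineDeg_le_potential U l
    rw [← hD, ← Real.rpow_natCast] at this
    exact (Real.rpow_le_rpow_left_iff (by norm_num)).1 this
  have hd : 0 < (1 + ξ) * D * p := by positivity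
  set d := (1 + ξ) * D * p with hd_def
  have hW : (1 - ξ) * D * ((1 - ξ) * potential U) ≤ ∑ e ∈ U, cellWt U e := by
    rw [sum_cellWt]
    have hl : ∀ l, (1 - ξ) * D * ((2 : ℝ) ^ lineDeg U l - 2 ^ ((1 - ξ) * D))
        ≤ 2 ^ lineDeg U l * lineDeg U l := by
      intro l
      have hx : 0 ≤ (1 - ξ) * D := mul_nonneg (by linarith) hD0.le
      rcases le_total ((1 - ξ) * D) (lineDeg U l) with h | h
      · have h3 : (0 : ℝ) < 2 ^ ((1 - ξ) * D) := by positivity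
        have h4 : (0 : ℝ) < 2 ^ lineDeg U l := by positivity
        nlinarith
      · have h3 : (2 : ℝ) ^ lineDeg U l ≤ 2 ^ ((1 - ξ) * D) := by
          rw [← Real.rpow_natCast]
          exact Real.rpow_le_rpow_of_exponent_le (by norm_num) h
        have h4 : (0 : ℝ) ≤ 2 ^ lineDeg U l * lineDeg U l := by positivity
        nlinarith
    refine le_trans ?_ (Finset.sum_le_sum fun l _ => hl l)
    rw [← Finset.mul_sum]
    refine mul_le_mul_of_nonneg_left ?_ (mul_nonneg (by linarith) hD0.le)
    rw [Finset.sum_sub_distrib, Finset.sum_const, Finset.card_univ, Fintype.card_sum,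
      nsmul_eq_mul]
    push_cast
    have : ∑ l, (2 : ℝ) ^ lineDeg U l = potential U := rfl
    rw [this, ← hD]
    linarith
  have hcell : ∀ e ∈ U, p * (1 - 2 * ξ) ≤ ∑ m : V × V → Bool, piWt (fun _ => bern p) m *
        (if e ∈ trimmed (U.filter fun x => m x = true) d then 1 else 0) :=
    fun e he => le_sum_piWt_mem_trimmed hp he ht d D hdeg h1
  have hE : p * (1 - 2 * ξ) * ∑ e ∈ U, cellWt U e ≤ ∑ m : V × V → Bool,
      piWt (fun _ => bern p) m *
        ∑ e ∈ trimmed (U.filter fun x => m x = true) d, cellWt U e := by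
    have hs : ∀ m : V × V → Bool, ∑ e ∈ trimmed (U.filter fun x => m x = true) d, cellWt U e
        = ∑ e ∈ U, (if e ∈ trimmed (U.filter fun x => m x = true) d then 1 else 0)
          * cellWt U e := by
      intro m
      simp_rw [ite_mul, one_mul, zero_mul]
      rw [← Finset.sum_filter]
      refine Finset.sum_congr ?_ fun _ _ => rfl
      ext e
      simp only [Finset.mem_filter]
      exact ⟨fun h => ⟨Finset.filter_subset _ _ (trimmed_subset _ _ h), h⟩, fun h => h.2⟩
    simp_rw [hs, Finset.mul_sum]
    rw [Finset.sum_comm]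
    refine Finset.sum_le_sum fun e he => ?_
    simp_rw [← mul_assoc]
    rw [← Finset.sum_mul]
    exact mul_le_mul_of_nonneg_right (hcell e he) (cellWt_nonneg U e)
  have hstep : ∑ m : V × V → Bool, piWt (fun _ => bern p) m *
        potential (U \ pickMatching U (U.filter fun x => m x = true))
      ≤ ∑ m : V × V → Bool, piWt (fun _ => bern p) m * (potential U -
        (∑ e ∈ trimmed (U.filter fun x => m x = true) d, cellWt U e) / (2 * d)) :=
    Finset.sum_le_sum fun m _ => mul_le_mul_of_nonneg_left
      (potential_sdiff_pickMatching_le (Finset.filter_subset _ _) hd)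
      (piWt_nonneg (fun _ _ => bern_nonneg hp _) _)
  refine hstep.trans ?_
  simp_rw [mul_sub, Finset.sum_sub_distrib]
  rw [← Finset.sum_mul, sum_piWt_eq_one fun _ => sum_bern p, one_mul]
  simp_rw [← mul_div_assoc]
  rw [← Finset.sum_div, sub_mul, one_mul]
  refine sub_le_sub_left ?_ _
  rw [le_div_iff₀ (by positivity)]
  refine le_trans ?_ hE
  calc (1 - 2 * ξ) * (1 - ξ) ^ 2 / (2 * (1 + ξ)) * potential U * (2 * d)
      = p * (1 - 2 * ξ) * ((1 - ξ) * D * ((1 - ξ) * potential U)) := by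
        rw [hd_def]
        field_simp
    _ ≤ _ := mul_le_mul_of_nonneg_left hW (mul_nonneg hp.1 (by linarith))

end Step

/-! ### The colour-by-colour matching process -/

section Leftover

variable {V Q : Type*}

/-- No colour is used twice on a line. -/
def IsProper (F : V × V → Option Q) : Prop :=
  ∀ l e f c, onLine l e → onLine l f → F e = some c → F f = some c → e = f

/-- `F` is a proper partial colouring of the cells of `U` from the lists `S`. -/
def IsListColouring (S : V × V → Q → Bool) (U : Finset (V × V)) (F : V × V → Option Q) : Prop :=
  IsProper F ∧ ∀ e c, F e = some c → e ∈ U ∧ S e c = true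

/-- The cells of `U` which receive no colour. -/
def uncoloured (U : Finset (V × V)) (F : V × V → Option Q) : Finset (V × V) :=
  U.filter fun e => F e = none

lemma mem_uncoloured {U : Finset (V × V)} {F : V × V → Option Q} {e : V × V} :
    e ∈ uncoloured U F ↔ e ∈ U ∧ F e = none := by
  simp [uncoloured]

/-- The cells which are left after successively removing matchings, one for each colour. -/
def leftover [DecidableEq V] (M : Q → V × V → Bool) : List Q → Finset (V × V) → Finset (V × V)
  | [], U => U
  | c :: L, U => leftover M L (U \ pickMatching U (U.filter fun e => M c e = true))

lemma leftover_congr [DecidableEq V] {M M' : Q → V × V → Bool} {L : List Q} (h : ∀ c ∈ L, M c = M' c)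
    (U : Finset (V × V)) : leftover M L U = leftover M' L U := by
  induction L generalizing U with
  | nil => rfl
  | cons c L ih =>
    simp only [leftover]
    rw [h c (by simp), ih fun c' hc' => h c' (by simp [hc'])]

lemma exists_colouring_of_leftover [DecidableEq V] (M : Q → V × V → Bool) {L : List Q} (hL : L.Nodup)
    (U : Finset (V × V)) : ∃ F : V × V → Option Q,
      IsListColouring (fun e c => M c e) U F ∧ (∀ e c, F e = some c → c ∈ L) ∧
        uncoloured U F ⊆ leftover M L U := by
  induction L generalizing U with
  | nil =>
    exact ⟨fun _ => none, ⟨by simp [IsProper], by simp⟩, by simp,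
      fun e he => (mem_uncoloured.1 he).1⟩
  | cons c L ih =>
    set N := pickMatching U (U.filter fun e => M c e = true) with hN
    have hNU : ∀ e ∈ N, e ∈ U ∧ M c e = true := fun e he => by
      simpa using pickMatching_subset _ _ he
    obtain ⟨F, ⟨hprop, hlist⟩, hcol, hun⟩ := ih hL.of_cons (U \ N)
    have hc : c ∉ L := (List.nodup_cons.1 hL).1
    have hFN : ∀ e ∈ N, F e = none := by
      intro e he
      by_contra hne
      obtain ⟨c', hc'⟩ := Option.ne_none_iff_exists'.1 hne
      exact (Finset.mem_sdiff.1 (hlist e c' hc').1).2 he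
    refine ⟨fun e => if e ∈ N then some c else F e, ⟨?_, ?_⟩, ?_, ?_⟩
    · intro l e e' c' hl hl' h h'
      dsimp only at h h'
      split_ifs at h h' with h1 h2 h2
      · exact isLineMatching_pickMatching _ _ l e h1 e' h2 hl hl'
      · cases h
        exact absurd (hcol _ _ h') hc
      · cases h'
        exact absurd (hcol _ _ h) hc
      · exact hprop l e e' c' hl hl' h h'
    · intro e c' h
      dsimp only at h
      split_ifs at h with h1
      · cases h
        exact hNU e h1
      · have := hlist e c' h
        exact ⟨(Finset.mem_sdiff.1 this.1).1, this.2⟩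
    · intro e c' h
      dsimp only at h
      split_ifs at h with h1
      · cases h
        simp
      · exact List.mem_cons_of_mem _ (hcol e c' h)
    · intro e he
      rw [mem_uncoloured] at he
      obtain ⟨he1, he2⟩ := he
      split_ifs at he2 with h1
      exact hun (mem_uncoloured.2 ⟨Finset.mem_sdiff.2 ⟨he1, h1⟩, he2⟩)

lemma sum_leftover_le [Fintype V] [DecidableEq V] [Fintype Q] [DecidableEq Q] {p : ℝ}
    (hp : p ∈ Set.Icc (0 : ℝ) 1) {ρ : ℝ} (hρ : 0 ≤ ρ) (T : Finset (V × V) → ℝ)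
    (hT : ∀ U, ∑ m : V × V → Bool, piWt (fun _ => bern p) m *
      T (U \ pickMatching U (U.filter fun x => m x = true)) ≤ ρ * T U)
    {L : List Q} (hL : L.Nodup) (U : Finset (V × V)) :
    ∑ M : Q → V × V → Bool, piWt (fun _ => piWt fun _ => bern p) M * T (leftover M L U)
      ≤ ρ ^ L.length * T U := by
  have hw : ∀ (_ : Q), ∑ m : V × V → Bool, piWt (fun _ => bern p) m = 1 :=
    fun _ => sum_piWt_eq_one fun _ => sum_bern p
  have hw0 : ∀ m : V × V → Bool, 0 ≤ piWt (fun _ => bern p) m :=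
    piWt_nonneg fun _ _ => bern_nonneg hp _
  induction L generalizing U with
  | nil =>
    simp only [leftover, List.length_nil, pow_zero, one_mul]
    rw [← Finset.sum_mul, sum_piWt_eq_one hw, one_mul]
  | cons c L ih =>
    have hc : c ∉ L := (List.nodup_cons.1 hL).1
    have hres := sum_piWt_resample (fun _ : Q => piWt fun _ : V × V => bern p) c
      (fun m M => T (leftover M L (U \ pickMatching U (U.filter fun x => m x = true))))
      (fun m m' M => by
        congr 1
        refine leftover_congr (fun c' hc' => Function.update_of_ne ?_ _ _) _
        rintro rfl
        exact hc hc')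
    rw [hw c, one_mul] at hres
    simp only [leftover]
    rw [hres]
    simp_rw [Finset.mul_sum]
    rw [Finset.sum_comm]
    calc _ = ∑ m : V × V → Bool, piWt (fun _ => bern p) m *
          ∑ M : Q → V × V → Bool, piWt (fun _ => piWt fun _ => bern p) M *
            T (leftover M L (U \ pickMatching U (U.filter fun x => m x = true))) := by
          refine Finset.sum_congr rfl fun m _ => ?_
          rw [Finset.mul_sum]
          refine Finset.sum_congr rfl fun M _ => ?_
          ring
      _ ≤ ∑ m : V × V → Bool, piWt (fun _ => bern p) m *
          (ρ ^ L.length * T (U \ pickMatching U (U.filter fun x => m x = true))) :=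
          Finset.sum_le_sum fun m _ => mul_le_mul_of_nonneg_left (ih hL.of_cons _) (hw0 m)
      _ = ρ ^ L.length * ∑ m : V × V → Bool, piWt (fun _ => bern p) m *
          T (U \ pickMatching U (U.filter fun x => m x = true)) := by
          rw [Finset.mul_sum]
          refine Finset.sum_congr rfl fun m _ => ?_
          ring
      _ ≤ ρ ^ L.length * (ρ * T U) := mul_le_mul_of_nonneg_left (hT U) (by positivity)
      _ = _ := by rw [List.length_cons]; ring

lemma sum_listWt_comm {X C : Type*} [Fintype X] [DecidableEq X] [Fintype C] [DecidableEq C]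
    (p : ℝ) (F : (X → C → Bool) → ℝ) :
    ∑ S : X → C → Bool, piWt (fun _ => listWt p) S * F S
      = ∑ M : C → X → Bool, piWt (fun _ => piWt fun _ => bern p) M * F fun x c => M c x := by
  refine Fintype.sum_equiv (Equiv.piComm fun _ _ => Bool) _ _ fun S => ?_
  congr 1
  exact Finset.prod_comm

/-- The probability that the process leaves a set of cells of large potential is small. -/
lemma sum_listWt_no_colouring_le [Fintype V] [DecidableEq V] [Fintype Q] [DecidableEq Q] {p : ℝ}
    (hp : p ∈ Set.Icc (0 : ℝ) 1) {ρ B : ℝ} (hρ : 0 ≤ ρ) (hB : 1 ≤ B)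
    (hstep : ∀ U, B ≤ potential U → ∑ m : V × V → Bool, piWt (fun _ => bern p) m *
      potential (U \ pickMatching U (U.filter fun x => m x = true)) ≤ ρ * potential U)
    (U : Finset (V × V)) :
    ∑ S : V × V → Q → Bool, piWt (fun _ => listWt p) S *
        (if ∃ F, IsListColouring S U F ∧ potential (uncoloured U F) < B then 0 else 1)
      ≤ ρ ^ Fintype.card Q * (2 * Fintype.card V * 2 ^ Fintype.card V) := by
  let T : Finset (V × V) → ℝ := fun U => if B ≤ potential U then potential U else 0
  have hTle : ∀ U, T U ≤ potential U := by
    intro U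
    simp only [T]
    split_ifs
    · exact le_rfl
    · exact potential_nonneg U
  have hT0 : ∀ U, 0 ≤ T U := by
    intro U
    simp only [T]
    split_ifs
    · exact potential_nonneg U
    · exact le_rfl
  have hw0 : ∀ m : V × V → Bool, 0 ≤ piWt (fun _ => bern p) m :=
    piWt_nonneg fun _ _ => bern_nonneg hp _
  have hT : ∀ U, ∑ m : V × V → Bool, piWt (fun _ => bern p) m *
      T (U \ pickMatching U (U.filter fun x => m x = true)) ≤ ρ * T U := by
    intro U
    by_cases h : B ≤ potential U
    · have h1 : T U = potential U := if_pos h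
      rw [h1]
      refine le_trans (Finset.sum_le_sum fun m _ => ?_) (hstep U h)
      exact mul_le_mul_of_nonneg_left (hTle _) (hw0 m)
    · have h1 : T U = 0 := if_neg h
      rw [h1, mul_zero]
      refine (Finset.sum_eq_zero fun m _ => ?_).le
      rw [show T _ = 0 from if_neg fun h' =>
        h (h'.trans (potential_mono Finset.sdiff_subset)), mul_zero]
  rw [sum_listWt_comm]
  have := sum_leftover_le (Q := Q) hp hρ T hT (Finset.nodup_toList Finset.univ) U
  rw [Finset.length_toList, Finset.card_univ] at this
  refine (Finset.sum_le_sum fun M _ => mul_le_mul_of_nonneg_left ?_ (piWt_nonneg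
    (fun _ m => hw0 m) M)).trans (this.trans (mul_le_mul_of_nonneg_left
      ((hTle U).trans (potential_le U)) (by positivity)))
  split_ifs with h
  · exact hT0 _
  · obtain ⟨F, hF, -, hun⟩ := exists_colouring_of_leftover M
      (Finset.nodup_toList (Finset.univ : Finset Q)) U
    have h2 : B ≤ potential (leftover M Finset.univ.toList U) := by
      by_contra hlt
      exact h ⟨F, hF, (potential_mono hun).trans_lt (not_le.1 hlt)⟩
    rw [show T _ = _ from if_pos h2]
    linarith

end Leftover

/-! ### Greedy choices from random lists -/

section Greedy

variable {X C σ : Type*}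

/-- The weight of the lists contained in `Fb` is at most a proportion `b` of the total weight. -/
def ListAvoids [Fintype C] [DecidableEq C] (w : (C → Bool) → ℝ) (b : ℝ) (Fb : Finset C) : Prop :=
  ∑ s : C → Bool, w s * (if ∀ c, s c = true → c ∈ Fb then 1 else 0) ≤ b * ∑ s : C → Bool, w s

/-- A greedy procedure that visits the elements of `L` in turn and chooses at `x` a member of the
random list of `x` outside a small forbidden set fails with small probability. -/
lemma sum_greedy_fail_le [Fintype X] [DecidableEq X] [Fintype C] [DecidableEq C]
    (w : X → (C → Bool) → ℝ) (hw : ∀ x s, 0 ≤ w x s) {b : ℝ} (hb : 0 ≤ b)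
    (forb : σ → X → Finset C) (ext : σ → X → C → σ)
    (Inv : (X → C → Bool) → List X → σ → Prop)
    (hsmall : ∀ S x L st, Inv S (x :: L) st → ListAvoids (w x) b (forb st x))
    (hext : ∀ S x L st, Inv S (x :: L) st →
      ∀ c, c ∉ forb st x → S x c = true → Inv S L (ext st x c))
    {L : List X} (hL : L.Nodup) (init : (X → C → Bool) → σ)
    (hinit : ∀ x ∈ L, ∀ S t, init (Function.update S x t) = init S) :
    ∑ S : X → C → Bool, piWt w S *
        (if Inv S L (init S) ∧ ¬ ∃ st, Inv S [] st then 1 else 0)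
      ≤ L.length * b * ∑ S : X → C → Bool, piWt w S := by
  induction L generalizing init with
  | nil =>
    have : ∀ S, ¬ (Inv S [] (init S) ∧ ¬ ∃ st, Inv S [] st) := fun S h => h.2 ⟨_, h.1⟩
    simp only [if_neg (this _)]
    simp
  | cons x L ih =>
    have hx : x ∉ L := (List.nodup_cons.1 hL).1
    let init' : (X → C → Bool) → σ := fun S =>
      if h : ∃ c, c ∉ forb (init S) x ∧ S x c = true then ext (init S) x h.choose else init S
    have hinit' : ∀ y ∈ L, ∀ S t, init' (Function.update S y t) = init' S := by
      intro y hy S t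
      have h1 := hinit y (List.mem_cons_of_mem _ hy) S t
      have h2 : Function.update S y t x = S x := Function.update_of_ne (by
        rintro rfl
        exact hx hy) _ _
      simp only [init', h1, h2]
    have hrec := ih hL.of_cons init' hinit'
    let f : (C → Bool) → (X → C → Bool) → ℝ := fun s S =>
      if ListAvoids (w x) b (forb (init S) x) then
        (if ∀ c, s c = true → c ∈ forb (init S) x then 1 else 0) else 0
    have hf : ∀ s s' S, f s (Function.update S x s') = f s S := by
      intro s s' S
      simp only [f, hinit x (by simp) S s']
    have hres := sum_piWt_resample w x f hf
    have hfle : ∀ S, ∑ s, w x s * f s S ≤ b * ∑ s, w x s := by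
      intro S
      by_cases h : ListAvoids (w x) b (forb (init S) x)
      · simp only [f, h, if_true]
        exact h
      · simp only [f, h, if_false, mul_zero, Finset.sum_const_zero]
        exact mul_nonneg hb (Finset.sum_nonneg fun s _ => hw x s)
    have h0 : ∀ S, 0 ≤ piWt w S := piWt_nonneg hw
    have hmain : ∑ S : X → C → Bool, piWt w S * f (S x) S ≤ b * ∑ S : X → C → Bool, piWt w S := by
      have hW : 0 ≤ ∑ s, w x s := Finset.sum_nonneg fun s _ => hw x s
      rcases hW.eq_or_lt with h | h
      · have hz : ∀ S, piWt w S = 0 := by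
          intro S
          refine Finset.prod_eq_zero (Finset.mem_univ x) ?_
          exact (Finset.sum_eq_zero_iff_of_nonneg fun s _ => hw x s).1 h.symm (S x)
            (Finset.mem_univ _)
        simp [hz]
      · refine le_of_mul_le_mul_left ?_ h
        rw [hres]
        calc _ ≤ ∑ S, piWt w S * (b * ∑ s, w x s) :=
              Finset.sum_le_sum fun S _ => mul_le_mul_of_nonneg_left (hfle S) (h0 S)
          _ = _ := by rw [← Finset.sum_mul]; ring
    have hpt : ∀ S, (if Inv S (x :: L) (init S) ∧ ¬ ∃ st, Inv S [] st then (1 : ℝ) else 0)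
        ≤ f (S x) S + (if Inv S L (init' S) ∧ ¬ ∃ st, Inv S [] st then 1 else 0) := by
      intro S
      have hf0 : 0 ≤ f (S x) S := by
        simp only [f]
        split_ifs <;> norm_num
      by_cases h : Inv S (x :: L) (init S) ∧ ¬ ∃ st, Inv S [] st
      · rw [if_pos h]
        by_cases hc : ∃ c, c ∉ forb (init S) x ∧ S x c = true
        · have : Inv S L (init' S) := by
            simp only [init', dif_pos hc]
            exact hext S x L _ h.1 _ hc.choose_spec.1 hc.choose_spec.2
          rw [if_pos ⟨this, h.2⟩]
          linarith
        · have h1 : f (S x) S = 1 := by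
            simp only [f]
            rw [if_pos (hsmall S x L _ h.1), if_pos]
            intro c hcS
            by_contra hcf
            exact hc ⟨c, hcf, hcS⟩
          rw [h1]
          split_ifs <;> norm_num
      · rw [if_neg h]
        split_ifs <;> linarith
    calc _ ≤ ∑ S : X → C → Bool, piWt w S * (f (S x) S
          + (if Inv S L (init' S) ∧ ¬ ∃ st, Inv S [] st then 1 else 0)) :=
          Finset.sum_le_sum fun S _ => mul_le_mul_of_nonneg_left (hpt S) (h0 S)
      _ ≤ _ := by
          simp_rw [mul_add]
          rw [Finset.sum_add_distrib, List.length_cons]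
          push_cast
          linarith

end Greedy

/-! ### Greedy list colouring -/

section GreedyColouring

variable {V C : Type*}

/-- The colours used by `h` on the cells of `T`. -/
def usedColours [DecidableEq C] (T : Finset (V × V)) (h : V × V → Option C) : Finset C :=
  T.biUnion fun e => (h e).toFinset

lemma mem_usedColours [DecidableEq C] {T : Finset (V × V)} {h : V × V → Option C} {c : C} :
    c ∈ usedColours T h ↔ ∃ e ∈ T, h e = some c := by
  simp [usedColours, Option.mem_toFinset, Option.mem_def]

lemma card_usedColours_le [DecidableEq C] (T : Finset (V × V)) (h : V × V → Option C) :
    (usedColours T h).card ≤ T.card := by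
  refine (Finset.card_biUnion_le_card_mul _ _ 1 fun e _ => ?_).trans_eq (mul_one _)
  cases h e <;> simp

/-- The colours used by `h` on the row and the column of `x`, among the cells of `D`. -/
def lineColours [DecidableEq V] [DecidableEq C] (D : Finset (V × V)) (h : V × V → Option C)
    (x : V × V) : Finset C :=
  usedColours (D.filter (onLine (Sum.inl x.1)) ∪ D.filter (onLine (Sum.inr x.2))) h

lemma card_lineColours_le [DecidableEq V] [DecidableEq C] {D : Finset (V × V)} {r : ℕ}
    (hr : ∀ l, lineDeg D l ≤ r) (h : V × V → Option C) (x : V × V) :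
    (lineColours D h x).card ≤ 2 * r := by
  refine (card_usedColours_le _ _).trans ((Finset.card_union_le _ _).trans ?_)
  have h1 := hr (Sum.inl x.1)
  have h2 := hr (Sum.inr x.2)
  unfold lineDeg at h1 h2
  omega

lemma mem_lineColours [DecidableEq V] [DecidableEq C] {D : Finset (V × V)}
    {h : V × V → Option C} {x y : V × V} {l : V ⊕ V} {c : C} (hx : onLine l x) (hy : onLine l y)
    (hyD : y ∈ D) (hc : h y = some c) : c ∈ lineColours D h x := by
  refine mem_usedColours.2 ⟨y, ?_, hc⟩
  rw [Finset.mem_union, Finset.mem_filter, Finset.mem_filter]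
  rcases l with i | j
  · simp only [onLine, Sum.elim_inl] at hx
    exact Or.inl ⟨hyD, by rwa [hx]⟩
  · simp only [onLine, Sum.elim_inr] at hx
    exact Or.inr ⟨hyD, by rwa [hx]⟩

lemma IsListColouring.update [DecidableEq V] [DecidableEq C] {S : V × V → C → Bool}
    {D : Finset (V × V)} {h : V × V → Option C} (hh : IsListColouring S D h) {x : V × V}
    (hx : x ∈ D) {c : C} (hc : c ∉ lineColours D h x) (hS : S x c = true) :
    IsListColouring S D (Function.update h x (some c)) := by
  refine ⟨?_, ?_⟩
  · intro l e e' c' hl hl' h1 h2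
    rw [Function.update_apply] at h1 h2
    split_ifs at h1 h2 with h3 h4 h4
    · exact h3.trans h4.symm
    · cases h1
      subst h3
      exact absurd (mem_lineColours hl hl' (hh.2 _ _ h2).1 h2) hc
    · cases h2
      subst h4
      exact absurd (mem_lineColours hl' hl (hh.2 _ _ h1).1 h1) hc
    · exact hh.1 l e e' c' hl hl' h1 h2
  · intro e c' h1
    rw [Function.update_apply] at h1
    split_ifs at h1 with h3
    · cases h1
      subst h3
      exact ⟨hx, hS⟩
    · exact hh.2 _ _ h1

/-- Greedy colouring of the cells of `D` from random lists.  Besides the colours already used on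
the lines of the cell, an `extra` set of colours is forbidden in order to preserve the property
`Good` of the colouring, which may depend on the lists outside of `D` through `φ`. -/
lemma sum_greedy_colouring_fail_le [Fintype V] [DecidableEq V] [Fintype C] [DecidableEq C]
    {Φ : Type*} (w : V × V → (C → Bool) → ℝ) (hw : ∀ x s, 0 ≤ w x s) {b : ℝ} (hb : 0 ≤ b)
    {D : Finset (V × V)} {r r' : ℕ} (hr : ∀ l, lineDeg D l ≤ r)
    (φ : (V × V → C → Bool) → Φ) (hφ : ∀ x ∈ D, ∀ S t, φ (Function.update S x t) = φ S)
    (Good : Φ → (V × V → Option C) → Prop)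
    (extra : Φ → (V × V → Option C) → V × V → Finset C)
    (hextra : ∀ f h x, x ∈ D → Good f h → IsProper h → (∀ e c, h e = some c → e ∈ D) →
      (extra f h x).card ≤ r')
    (hgood : ∀ f h x c, Good f h → h x = none → c ∉ extra f h x →
      Good f (Function.update h x (some c)))
    (hsmall : ∀ x ∈ D, ∀ Fb : Finset C, Fb.card ≤ 2 * r + r' → ListAvoids (w x) b Fb) :
    ∑ S : V × V → C → Bool, piWt w S *
        (if Good (φ S) (fun _ => none) ∧ ¬ ∃ h, IsListColouring S D h ∧ (∀ e ∈ D, h e ≠ none) ∧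
          Good (φ S) h then 1 else 0)
      ≤ D.card * b * ∑ S : V × V → C → Bool, piWt w S := by
  let Inv : (V × V → C → Bool) → List (V × V) → Φ × (V × V → Option C) → Prop :=
    fun S L st => st.1 = φ S ∧ IsListColouring S D st.2 ∧ Good st.1 st.2 ∧ L.Nodup ∧
      (∀ e ∈ L, e ∈ D) ∧ ∀ e ∈ D, st.2 e = none ↔ e ∈ L
  have key := sum_greedy_fail_le w hw hb
    (fun st x => lineColours D st.2 x ∪ extra st.1 st.2 x)
    (fun st x c => (st.1, Function.update st.2 x (some c))) Inv
    (by
      rintro S x L ⟨f, h⟩ ⟨-, h2, h3, -, h5, -⟩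
      have hx : x ∈ D := h5 x (by simp)
      refine hsmall x hx _ ((Finset.card_union_le _ _).trans (add_le_add
        (card_lineColours_le hr _ _) (hextra _ _ _ hx h3 h2.1 fun e c hec => (h2.2 e c hec).1))))
    (by
      rintro S x L ⟨f, h⟩ ⟨h1, h2, h3, h4, h5, h6⟩ c hc hS
      dsimp only at h1 h2 h3 h6 hc
      rw [Finset.mem_union, not_or] at hc
      have hx : x ∈ D := h5 x (by simp)
      have hxL : x ∉ L := (List.nodup_cons.1 h4).1
      refine ⟨h1, h2.update hx hc.1 hS, hgood _ _ _ _ h3 ((h6 x hx).2 (by simp)) hc.2,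
        h4.of_cons, fun e he => h5 e (by simp [he]), fun e he => ?_⟩
      dsimp only
      rw [Function.update_apply]
      split_ifs with hex
      · subst hex
        simp [hxL]
      · rw [h6 e he]
        simp [hex])
    (Finset.nodup_toList D) (fun S => (φ S, fun _ => none))
    (by
      intro x hx S t
      rw [hφ x (by simpa using hx)])
  rw [Finset.length_toList] at key
  refine le_trans (Finset.sum_le_sum fun S _ => mul_le_mul_of_nonneg_left ?_
    (piWt_nonneg hw S)) key
  by_cases h : Good (φ S) (fun _ => none) ∧ ¬ ∃ h, IsListColouring S D h ∧
      (∀ e ∈ D, h e ≠ none) ∧ Good (φ S) h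
  · rw [if_pos h, if_pos]
    refine ⟨⟨rfl, ⟨by simp [IsProper], by simp⟩, h.1, Finset.nodup_toList D, by simp, by simp⟩, ?_⟩
    rintro ⟨⟨f, g⟩, h1, h2, h3, -, -, h6⟩
    dsimp only at h1 h2 h3 h6
    subst h1
    exact h.2 ⟨g, h2, fun e he hne => by simpa using (h6 e he).1 hne, h3⟩
  · rw [if_neg h]
    split_ifs <;> norm_num

end GreedyColouring

/-! ### Conflicts between two partial colourings -/

section Conflicts

variable {V C : Type*}

lemma sum_no_completion_le [Fintype V] [DecidableEq V] [Fintype C] [DecidableEq C]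
    (w : V × V → (C → Bool) → ℝ) (hw : ∀ x s, 0 ≤ w x s) {b : ℝ} (hb : 0 ≤ b)
    {U : Finset (V × V)} {r : ℕ} (hr : ∀ l, lineDeg U l ≤ r)
    (hsmall : ∀ x ∈ U, ∀ Fb : Finset C, Fb.card ≤ 2 * r → ListAvoids (w x) b Fb) :
    ∑ S : V × V → C → Bool, piWt w S *
        (if ∃ h, IsListColouring S U h ∧ ∀ e ∈ U, h e ≠ none then 0 else 1)
      ≤ U.card * b * ∑ S : V × V → C → Bool, piWt w S := by
  refine le_trans (Finset.sum_le_sum fun S _ => mul_le_mul_of_nonneg_left ?_ (piWt_nonneg hw S))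
    (sum_greedy_colouring_fail_le (Φ := Unit) (r' := 0) w hw hb hr (fun _ => ())
      (fun _ _ _ _ => rfl) (fun _ _ => True) (fun _ _ _ => ∅) (by simp) (by simp) hsmall)
  by_cases h : ∃ h, IsListColouring S U h ∧ ∀ e ∈ U, h e ≠ none
  · rw [if_pos h]
    split_ifs <;> norm_num
  · rw [if_neg h, if_pos]
    refine ⟨trivial, ?_⟩
    rintro ⟨g, h1, h2, -⟩
    exact h ⟨g, h1, h2⟩

/-- The number of cells in row `i` whose colour under `F` is used by `h` in their column. -/
def rowLoad [Fintype V] (F h : V × V → Option C) (i : V) : ℕ :=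
  (Finset.univ.filter fun j => ∃ i' c, F (i, j) = some c ∧ h (i', j) = some c).card

/-- The colours whose use at `x` would increase the load of a row of load at least `T`. -/
def rowExtra [Fintype V] [DecidableEq V] [DecidableEq C] (F h : V × V → Option C) (T : ℕ)
    (x : V × V) : Finset C :=
  usedColours ((Finset.univ.filter fun i => T ≤ rowLoad F h i).image fun i => (i, x.2)) F

lemma rowLoad_update_le [Fintype V] [DecidableEq V] [DecidableEq C] {F h : V × V → Option C}
    {T : ℕ} {x : V × V} {c : C} (hc : c ∉ rowExtra F h T x) (hT : ∀ i, rowLoad F h i ≤ T)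
    (i : V) : rowLoad F (Function.update h x (some c)) i ≤ T := by
  by_cases hF : F (i, x.2) = some c
  · have hlt : rowLoad F h i < T := by
      by_contra! hle
      refine hc (mem_usedColours.2 ⟨(i, x.2), ?_, hF⟩)
      exact Finset.mem_image.2 ⟨i, by simpa using hle, rfl⟩
    refine le_trans ?_ (Nat.succ_le_of_lt hlt)
    refine le_trans (Finset.card_le_card ?_) (Finset.card_insert_le x.2 _)
    intro j hj
    simp only [Finset.mem_filter, Finset.mem_univ, true_and, Finset.mem_insert] at hj ⊢
    obtain ⟨i', c', h1, h2⟩ := hj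
    rw [Function.update_apply] at h2
    split_ifs at h2 with h3
    · left
      rw [← h3]
    · exact Or.inr ⟨i', c', h1, h2⟩
  · refine le_trans (Finset.card_le_card ?_) (hT i)
    intro j hj
    simp only [Finset.mem_filter, Finset.mem_univ, true_and] at hj ⊢
    obtain ⟨i', c', h1, h2⟩ := hj
    rw [Function.update_apply] at h2
    split_ifs at h2 with h3
    · cases h2
      rw [← h3] at hF
      exact absurd h1 hF
    · exact ⟨i', c', h1, h2⟩

lemma mul_card_overloaded_le [Fintype V] [DecidableEq V] {F h : V × V → Option C}
    (hF : IsProper F) {D : Finset (V × V)} (hD : ∀ e c, h e = some c → e ∈ D) (T : ℕ) :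
    T * (Finset.univ.filter fun i => T ≤ rowLoad F h i).card ≤ D.card := by
  have h1 : T * (Finset.univ.filter fun i => T ≤ rowLoad F h i).card
      ≤ ∑ i, rowLoad F h i := by
    rw [mul_comm, ← smul_eq_mul]
    refine (Finset.card_nsmul_le_sum _ _ _ fun i hi => ?_).trans
      (Finset.sum_le_sum_of_subset (Finset.filter_subset _ _))
    simpa using hi
  refine h1.trans ?_
  have h2 : ∑ i, rowLoad F h i = (Finset.univ.filter fun e : V × V =>
      ∃ i' c, F e = some c ∧ h (i', e.2) = some c).card := by
    rw [Finset.card_filter, Fintype.sum_prod_type]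
    refine Finset.sum_congr rfl fun i _ => ?_
    rw [rowLoad, Finset.card_filter]
  rw [h2]
  have hex : ∀ e ∈ (Finset.univ.filter fun e : V × V =>
      ∃ i' c, F e = some c ∧ h (i', e.2) = some c), ∃ i' c, F e = some c ∧ h (i', e.2) = some c :=
    fun e he => by simpa using he
  rcases isEmpty_or_nonempty V with hV | hV
  · rw [Finset.eq_empty_of_isEmpty (Finset.filter _ _)]
    exact Nat.zero_le _
  choose! r hr using hex
  refine Finset.card_le_card_of_injOn (fun e => (r e, e.2)) ?_ ?_
  · intro e he
    obtain ⟨c, -, h4⟩ := hr e he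
    exact hD _ _ h4
  · intro e he e' he' heq
    obtain ⟨h5, h6⟩ := Prod.mk.inj heq
    obtain ⟨c, h3, h4⟩ := hr e he
    obtain ⟨c', h3', h4'⟩ := hr e' he'
    rw [h5, h6, h4'] at h4
    cases h4
    exact hF (Sum.inr e'.2) e e' c h6 rfl h3 h3'

lemma card_rowExtra_le [Fintype V] [DecidableEq V] [DecidableEq C] {F h : V × V → Option C}
    (hF : IsProper F) {D : Finset (V × V)} (hD : ∀ e c, h e = some c → e ∈ D) {T r : ℕ}
    (hT : 0 < T) (hr : D.card ≤ T * r) (x : V × V) : (rowExtra F h T x).card ≤ r := by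
  refine (card_usedColours_le _ _).trans (Finset.card_image_le.trans ?_)
  exact Nat.le_of_mul_le_mul_left ((mul_card_overloaded_le hF hD T).trans hr) hT

lemma IsProper.swap {F : V × V → Option C} (hF : IsProper F) : IsProper (F ∘ Prod.swap) := by
  intro l e e' c hl hl' h1 h2
  refine Prod.swap_injective (hF l.swap e.swap e'.swap c ?_ ?_ h1 h2)
  · rcases l with i | j <;> exact hl
  · rcases l with i | j <;> exact hl'

/-- The cell `e` has the same colour under `F` as a cell on a common line has under `h`. -/
def Conflicting (F h : V × V → Option C) (e : V × V) : Prop :=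
  ∃ l y c, onLine l e ∧ onLine l y ∧ F e = some c ∧ h y = some c

/-- The colouring `F`, overridden by `h`, with the conflicting cells uncoloured. -/
def override (F h : V × V → Option C) (e : V × V) : Option C :=
  if h e = none then if Conflicting F h e then none else F e else h e

lemma override_eq_some {F h : V × V → Option C} {e : V × V} {c : C}
    (H : override F h e = some c) :
    h e = some c ∨ (h e = none ∧ ¬ Conflicting F h e ∧ F e = some c) := by
  unfold override at H
  split_ifs at H with h1 h2
  · exact Or.inr ⟨h1, h2, H⟩
  · exact Or.inl H

lemma isProper_override {F h : V × V → Option C} (hF : IsProper F) (hh : IsProper h) :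
    IsProper (override F h) := by
  intro l e e' c hl hl' h1 h2
  rcases override_eq_some h1 with h1 | ⟨-, hc, h1⟩ <;>
    rcases override_eq_some h2 with h2 | ⟨-, hc', h2⟩
  · exact hh l e e' c hl hl' h1 h2
  · exact absurd ⟨l, e, c, hl', hl, h2, h1⟩ hc'
  · exact absurd ⟨l, e', c, hl, hl', h1, h2⟩ hc
  · exact hF l e e' c hl hl' h1 h2

lemma lineDeg_uncoloured_override_inl_le [Fintype V] [DecidableEq V]
    {F h : V × V → Option C} (hF : IsProper F) {D U : Finset (V × V)}
    (hD : ∀ e c, h e = some c → e ∈ D) (hU : ∀ e, e ∉ U → h e ≠ none) (i : V) :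
    lineDeg (uncoloured Finset.univ (override F h)) (Sum.inl i)
      ≤ lineDeg (uncoloured U F) (Sum.inl i) + lineDeg D (Sum.inl i) + rowLoad F h i := by
  have hsub : (uncoloured Finset.univ (override F h)).filter (onLine (Sum.inl i))
      ⊆ ((uncoloured U F).filter (onLine (Sum.inl i)) ∪
          (Finset.univ.filter fun e : V × V => onLine (Sum.inl i) e ∧
            ∃ j' c, F e = some c ∧ h (i, j') = some c)) ∪
        ((Finset.univ.filter fun j => ∃ i' c, F (i, j) = some c ∧ h (i', j) = some c).image
          fun j => (i, j)) := by
    rintro ⟨a, j⟩ he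
    rw [Finset.mem_filter, mem_uncoloured] at he
    obtain ⟨⟨-, h1⟩, h2⟩ := he
    have h2' : a = i := h2
    subst h2'
    unfold override at h1
    split_ifs at h1 with h3 h4
    · obtain ⟨l, y, c, hl, hl', h5, h6⟩ := h4
      rcases l with i' | j'
      · simp only [onLine, Sum.elim_inl] at hl hl'
        refine Finset.mem_union_left _ (Finset.mem_union_right _ ?_)
        simp only [Finset.mem_filter, Finset.mem_univ, true_and]
        refine ⟨h2, y.2, c, h5, ?_⟩
        rw [← h6, hl, ← hl']
      · simp only [onLine, Sum.elim_inr] at hl hl'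
        refine Finset.mem_union_right _ ?_
        simp only [Finset.mem_image, Finset.mem_filter, Finset.mem_univ, true_and]
        refine ⟨j, ⟨y.1, c, h5, ?_⟩, rfl⟩
        rw [← h6, hl, ← hl']
    · refine Finset.mem_union_left _ (Finset.mem_union_left _ ?_)
      rw [Finset.mem_filter, mem_uncoloured]
      refine ⟨⟨?_, h1⟩, h2⟩
      by_contra hne
      exact hU _ hne h3
    · exact absurd h1 h3
  refine (Finset.card_le_card hsub).trans ((Finset.card_union_le _ _).trans (add_le_add
    ((Finset.card_union_le _ _).trans (add_le_add le_rfl ?_)) Finset.card_image_le))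
  have hex : ∀ e ∈ (Finset.univ.filter fun e : V × V => onLine (Sum.inl i) e ∧
      ∃ j' c, F e = some c ∧ h (i, j') = some c),
      onLine (Sum.inl i) e ∧ ∃ j' c, F e = some c ∧ h (i, j') = some c :=
    fun e he => by simpa using he
  have hex2 := fun e he => (hex e he).2
  have : Nonempty V := ⟨i⟩
  choose! r hr using hex2
  refine Finset.card_le_card_of_injOn (fun e => (i, r e)) ?_ ?_
  · intro e he
    obtain ⟨c, -, h4⟩ := hr e he
    rw [Finset.mem_coe, Finset.mem_filter]
    exact ⟨hD _ _ h4, rfl⟩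
  · intro e he e' he' heq
    have h5 : r e = r e' := (Prod.mk.inj heq).2
    obtain ⟨c, h3, h4⟩ := hr e he
    obtain ⟨c', h3', h4'⟩ := hr e' he'
    rw [h5, h4'] at h4
    cases h4
    exact hF (Sum.inl i) e e' c (hex e he).1 (hex e' he').1 h3 h3'

lemma lineDeg_image_swap (U : Finset (V × V)) (l : V ⊕ V) :
    lineDeg (U.map ⟨Prod.swap, Prod.swap_injective⟩) l = lineDeg U l.swap := by
  unfold lineDeg
  rw [Finset.filter_map, Finset.card_map]
  congr 1
  refine Finset.filter_congr fun e _ => ?_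
  rcases l with i | j <;> rfl

lemma conflicting_swap {F h : V × V → Option C} {e : V × V} :
    Conflicting (F ∘ Prod.swap) (h ∘ Prod.swap) e.swap ↔ Conflicting F h e := by
  constructor
  · rintro ⟨l, y, c, h1, h2, h3, h4⟩
    refine ⟨l.swap, y.swap, c, ?_, ?_, h3, h4⟩
    · rcases l with i | j <;> exact h1
    · rcases l with i | j <;> exact h2
  · rintro ⟨l, y, c, h1, h2, h3, h4⟩
    refine ⟨l.swap, y.swap, c, ?_, ?_, by simpa using h3, by simpa using h4⟩
    · rcases l with i | j <;> exact h1
    · rcases l with i | j <;> exact h2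

lemma lineDeg_uncoloured_override_le [Fintype V] [DecidableEq V]
    {F h : V × V → Option C} (hF : IsProper F) {D U : Finset (V × V)}
    (hD : ∀ e c, h e = some c → e ∈ D) (hU : ∀ e, e ∉ U → h e ≠ none) {T : ℕ}
    (h1 : ∀ i, rowLoad F h i ≤ T) (h2 : ∀ j, rowLoad (F ∘ Prod.swap) (h ∘ Prod.swap) j ≤ T)
    (l : V ⊕ V) :
    lineDeg (uncoloured Finset.univ (override F h)) l
      ≤ lineDeg (uncoloured U F) l + lineDeg D l + T := by
  rcases l with i | j
  · exact (lineDeg_uncoloured_override_inl_le hF hD hU i).trans (Nat.add_le_add_left (h1 i) _)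
  · have := lineDeg_uncoloured_override_inl_le (F := F ∘ Prod.swap) (h := h ∘ Prod.swap)
      (D := D.map ⟨Prod.swap, Prod.swap_injective⟩) (U := U.map ⟨Prod.swap, Prod.swap_injective⟩)
      hF.swap (fun e c he => Finset.mem_map.2 ⟨e.swap, hD _ _ he, Prod.swap_swap e⟩)
      (fun e he => hU _ fun h => he (Finset.mem_map.2 ⟨e.swap, h, Prod.swap_swap e⟩)) j
    have e1 : uncoloured Finset.univ (override (F ∘ Prod.swap) (h ∘ Prod.swap))
        = (uncoloured Finset.univ (override F h)).map ⟨Prod.swap, Prod.swap_injective⟩ := by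
      ext e
      rw [mem_uncoloured, Finset.mem_map]
      have h3 : override (F ∘ Prod.swap) (h ∘ Prod.swap) e = override F h e.swap := by
        unfold override
        simp only [← conflicting_swap (F := F) (h := h) (e := e.swap), Prod.swap_swap,
          Function.comp_apply]
      rw [h3]
      constructor
      · rintro ⟨-, h4⟩
        exact ⟨e.swap, mem_uncoloured.2 ⟨Finset.mem_univ _, h4⟩, Prod.swap_swap e⟩
      · rintro ⟨y, h4, rfl⟩
        exact ⟨Finset.mem_univ _, by simpa using (mem_uncoloured.1 h4).2⟩
    have e2 : uncoloured (U.map ⟨Prod.swap, Prod.swap_injective⟩) (F ∘ Prod.swap)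
        = (uncoloured U F).map ⟨Prod.swap, Prod.swap_injective⟩ := by
      ext e
      rw [mem_uncoloured, Finset.mem_map, Finset.mem_map]
      constructor
      · rintro ⟨⟨y, h4, rfl⟩, h5⟩
        exact ⟨y, mem_uncoloured.2 ⟨h4, by simpa using h5⟩, rfl⟩
      · rintro ⟨y, h4, rfl⟩
        exact ⟨⟨y, (mem_uncoloured.1 h4).1, rfl⟩, by simpa using (mem_uncoloured.1 h4).2⟩
    rw [e1, e2, lineDeg_image_swap, lineDeg_image_swap, lineDeg_image_swap] at this
    exact this.trans (Nat.add_le_add_left (h2 j) _)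

end Conflicts

/-! ### Precolouring a small set of cells -/

section Precolouring

variable {V C : Type*}

/-- The list `s` has at least `a` elements. -/
def LargeList [Fintype C] (a : ℝ) (s : C → Bool) : Prop :=
  a ≤ ((Finset.univ.filter fun c => s c = true).card : ℝ)

/-- The weight of a list, restricted to lists with at least `a` elements. -/
def largeWt [Fintype C] (p a : ℝ) (s : C → Bool) : ℝ :=
  listWt p s * if LargeList a s then 1 else 0

lemma largeWt_nonneg [Fintype C] {p : ℝ} (hp : p ∈ Set.Icc (0 : ℝ) 1) (a : ℝ) (s : C → Bool) :
    0 ≤ largeWt p a s := by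
  unfold largeWt
  have := listWt_nonneg hp s
  split_ifs <;> simp [this]

lemma largeWt_le [Fintype C] {p : ℝ} (hp : p ∈ Set.Icc (0 : ℝ) 1) (a : ℝ) (s : C → Bool) :
    largeWt p a s ≤ listWt p s := by
  unfold largeWt
  have := listWt_nonneg hp s
  split_ifs <;> simp [this]

/-- A partial list colouring that colours all of `D` and leaves at most `R` uncoloured cells on
every line. -/
def IsPrecolouring [Fintype V] (S : V × V → C → Bool) (D : Finset (V × V)) (R : ℕ)
    (g : V × V → Option C) : Prop :=
  IsListColouring S Finset.univ g ∧ (∀ e ∈ D, g e ≠ none) ∧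
    ∀ l, lineDeg (uncoloured Finset.univ g) l ≤ R

lemma isPrecolouring_override [Fintype V] [DecidableEq V]
    {S : V × V → C → Bool} {D : Finset (V × V)} {F h : V × V → Option C}
    (hF : IsListColouring S Dᶜ F) (hh : IsListColouring S D h) (hhD : ∀ e ∈ D, h e ≠ none)
    {rB r T : ℕ} (hB : potential (uncoloured Dᶜ F) < 2 ^ rB) (hr : ∀ l, lineDeg D l ≤ r)
    (h1 : ∀ i, rowLoad F h i ≤ T) (h2 : ∀ j, rowLoad (F ∘ Prod.swap) (h ∘ Prod.swap) j ≤ T) :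
    IsPrecolouring S D (rB + r + T) (override F h) := by
  refine ⟨⟨isProper_override hF.1 hh.1, fun e c he => ⟨Finset.mem_univ _, ?_⟩⟩, ?_, fun l => ?_⟩
  · rcases override_eq_some he with he | ⟨-, -, he⟩
    · exact (hh.2 e c he).2
    · exact (hF.2 e c he).2
  · intro e he
    rw [override, if_neg (hhD e he)]
    exact hhD e he
  · refine (lineDeg_uncoloured_override_le hF.1 (fun e c he => (hh.2 e c he).1) (U := Dᶜ)
      (fun e he => hhD e (by simpa using he)) h1 h2 l).trans ?_
    have h3 : (2 : ℝ) ^ lineDeg (uncoloured Dᶜ F) l < 2 ^ rB :=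
      (pow_lineDeg_le_potential _ l).trans_lt hB
    have h4 := (pow_lt_pow_iff_right₀ (by norm_num : (1 : ℝ) < 2)).1 h3
    have h5 := hr l
    omega

lemma isListColouring_update [DecidableEq V] {S : V × V → C → Bool} {U : Finset (V × V)}
    {x : V × V} (hx : x ∉ U) (t : C → Bool) (F : V × V → Option C) :
    IsListColouring (Function.update S x t) U F ↔ IsListColouring S U F := by
  unfold IsListColouring
  refine and_congr_right fun _ => forall_congr' fun e => forall_congr' fun c =>
    imp_congr_right fun _ => and_congr_right fun he => ?_
  rw [Function.update_of_ne]
  rintro rfl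
  exact hx he

lemma rowLoad_none [Fintype V] (F : V × V → Option C) (i : V) :
    rowLoad F (fun _ => none) i = 0 := by
  simp [rowLoad]

/-- The probability that the lists at `D` are large but there is no precolouring. -/
lemma sum_no_precolouring_le [Fintype V] [DecidableEq V] [Fintype C] [DecidableEq C] {p : ℝ}
    (hp : p ∈ Set.Icc (0 : ℝ) 1) {ρ : ℝ} (hρ : 0 ≤ ρ) {rB r T r' : ℕ}
    (hstep : ∀ U, (2 : ℝ) ^ rB ≤ potential U → ∑ m : V × V → Bool, piWt (fun _ => bern p) m *
      potential (U \ pickMatching U (U.filter fun x => m x = true)) ≤ ρ * potential U)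
    {D : Finset (V × V)} (hr : ∀ l, lineDeg D l ≤ r) (hT : 0 < T) (hr' : D.card ≤ T * r')
    {a b : ℝ} (hb : 0 ≤ b)
    (hsmall : ∀ Fb : Finset C, Fb.card ≤ 2 * r + 2 * r' → ListAvoids (largeWt p a) b Fb) :
    ∑ S : V × V → C → Bool, piWt (fun _ => listWt p) S *
        (if (∀ x ∈ D, LargeList a (S x)) ∧ ¬ ∃ g, IsPrecolouring S D (rB + r + T) g then 1 else 0)
      ≤ ρ ^ Fintype.card C * (2 * Fintype.card V * 2 ^ Fintype.card V) + D.card * b := by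
  let w : V × V → (C → Bool) → ℝ := fun x => if x ∈ D then largeWt p a else listWt p
  have hw : ∀ x s, 0 ≤ w x s := by
    intro x s
    simp only [w]
    split_ifs
    · exact largeWt_nonneg hp a s
    · exact listWt_nonneg hp s
  have hw1 : ∀ S : V × V → C → Bool, piWt w S ≤ piWt (fun _ => listWt p) S := by
    intro S
    refine Finset.prod_le_prod (fun x _ => hw x _) fun x _ => ?_
    simp only [w]
    split_ifs
    · exact largeWt_le hp a _
    · exact le_rfl
  have hw2 : ∀ S : V × V → C → Bool, (∀ x ∈ D, LargeList a (S x)) →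
      piWt (fun _ => listWt p) S = piWt w S := by
    intro S hS
    refine Finset.prod_congr rfl fun x _ => ?_
    simp only [w]
    split_ifs with hx
    · simp [largeWt, hS x hx]
    · rfl
  let Ok : (V × V → C → Bool) → (V × V → Option C) → Prop := fun S F =>
    IsListColouring S Dᶜ F ∧ potential (uncoloured Dᶜ F) < 2 ^ rB
  let φ : (V × V → C → Bool) → V × V → Option C := fun S => Classical.epsilon (Ok S)
  let Good : (V × V → Option C) → (V × V → Option C) → Prop := fun F h =>
    IsProper F ∧ (∀ i, rowLoad F h i ≤ T) ∧
      ∀ j, rowLoad (F ∘ Prod.swap) (h ∘ Prod.swap) j ≤ T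
  have hφ : ∀ x ∈ D, ∀ S t, φ (Function.update S x t) = φ S := by
    intro x hx S t
    have : Ok (Function.update S x t) = Ok S := by
      funext F
      simp only [Ok, isListColouring_update (U := Dᶜ) (x := x) (by simpa using hx)]
    simp only [φ, this]
  have greedy := sum_greedy_colouring_fail_le w hw hb hr φ hφ Good (r' := 2 * r')
    (fun F h x => rowExtra F h T x ∪ rowExtra (F ∘ Prod.swap) (h ∘ Prod.swap) T x.swap)
    (by
      rintro F h x - hg - hD
      refine (Finset.card_union_le _ _).trans ?_
      have h1 := card_rowExtra_le hg.1 hD hT hr' x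
      have h2 := card_rowExtra_le (F := F ∘ Prod.swap) (h := h ∘ Prod.swap)
        (D := D.map ⟨Prod.swap, Prod.swap_injective⟩) hg.1.swap
        (fun e c he => Finset.mem_map.2 ⟨e.swap, hD _ _ he, Prod.swap_swap e⟩) hT
        (by rwa [Finset.card_map]) x.swap
      omega)
    (by
      rintro F h x c ⟨h1, h2, h3⟩ - hc
      rw [Finset.mem_union, not_or] at hc
      refine ⟨h1, rowLoad_update_le hc.1 h2, ?_⟩
      have : Function.update h x (some c) ∘ Prod.swap
          = Function.update (h ∘ Prod.swap) x.swap (some c) := by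
        funext e
        simp only [Function.comp_apply, Function.update_apply]
        by_cases he : e = x.swap
        · subst he
          simp
        · rw [if_neg he, if_neg]
          rintro rfl
          exact he (Prod.swap_swap e).symm
      rw [this]
      exact rowLoad_update_le hc.2 h3)
    (by
      intro x hx Fb hFb
      simp only [w, if_pos hx]
      exact hsmall Fb hFb)
  have hle1 : ∑ S : V × V → C → Bool, piWt w S ≤ 1 := by
    rw [← sum_piWt_eq_one (w := fun _ : V × V => listWt (C := C) p) fun _ => sum_listWt p]
    exact Finset.sum_le_sum fun S _ => hw1 S
  have hproc := sum_listWt_no_colouring_le (Q := C) hp hρ (one_le_pow₀ (n := rB) one_le_two)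
    hstep Dᶜ
  refine le_trans ?_ (add_le_add hproc (greedy.trans (mul_le_of_le_one_right
    (by positivity) hle1)))
  rw [← Finset.sum_add_distrib]
  refine Finset.sum_le_sum fun S _ => ?_
  have h0 : 0 ≤ piWt (fun _ => listWt p) S := piWt_nonneg (fun _ => listWt_nonneg hp) S
  have h0' : 0 ≤ piWt w S := piWt_nonneg hw S
  by_cases hbad : (∀ x ∈ D, LargeList a (S x)) ∧ ¬ ∃ g, IsPrecolouring S D (rB + r + T) g
  · rw [if_pos hbad]
    by_cases hF : ∃ F, Ok S F
    · have hspec : Ok S (φ S) := Classical.epsilon_spec hF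
      rw [if_pos hF, mul_zero, zero_add, hw2 S hbad.1, if_pos]
      refine ⟨⟨hspec.1.1, fun i => ?_, fun j => ?_⟩, ?_⟩
      · rw [rowLoad_none]
        exact Nat.zero_le _
      · rw [show (fun _ : V × V => (none : Option C)) ∘ Prod.swap = fun _ => none from rfl,
          rowLoad_none]
        exact Nat.zero_le _
      · rintro ⟨h, hh, hhD, hg⟩
        exact hbad.2 ⟨_, isPrecolouring_override hspec.1 hh hhD hspec.2 hr hg.2.1 hg.2.2⟩
    · rw [if_neg hF]
      refine le_add_of_nonneg_right (mul_nonneg h0' ?_)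
      split_ifs <;> norm_num
  · rw [if_neg hbad, mul_zero]
    refine add_nonneg (mul_nonneg h0 ?_) (mul_nonneg h0' ?_) <;> split_ifs <;> norm_num

end Precolouring

/-! ### Colouring from random lists -/

section Combination

variable {V Q A : Type*}

/-- There is a proper colouring of all cells from the lists `S`. -/
def HasListColouring {C : Type*} (S : V × V → C → Bool) : Prop :=
  ∃ F : V × V → C, (∀ l e e', onLine l e → onLine l e' → F e = F e' → e = e') ∧
    ∀ e, S e (F e) = true

/-- The cells with few colours in their lists. -/
def smallCells [Fintype V] [Fintype A] (a : ℝ) (S : V × V → A → Bool) : Finset (V × V) :=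
  Finset.univ.filter fun x => ¬ LargeList a (S x)

lemma mem_smallCells [Fintype V] [Fintype A] {a : ℝ} {S : V × V → A → Bool} {x : V × V} :
    x ∈ smallCells a S ↔ ¬ LargeList a (S x) := by
  simp [smallCells]

lemma sum_piWt_apply {X β : Type*} [Fintype X] [DecidableEq X] [Fintype β] {w : X → β → ℝ}
    (hw : ∀ x, ∑ t, w x t = 1) (x : X) (g : β → ℝ) :
    ∑ S : X → β, piWt w S * g (S x) = ∑ t, w x t * g t := by
  have h := sum_piWt_resample w x (fun t _ => g t) (fun _ _ _ => rfl)
  rw [hw, one_mul] at h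
  rw [h, ← Finset.sum_mul, sum_piWt_eq_one hw, one_mul]

lemma sum_piWt_exists_le {X β : Type*} [Fintype X] [DecidableEq X] [Fintype β] {w : X → β → ℝ}
    (hw0 : ∀ x t, 0 ≤ w x t) (hw : ∀ x, ∑ t, w x t = 1) (B : β → Prop) {c : ℝ}
    (hc : ∀ x, ∑ t, w x t * (if B t then 1 else 0) ≤ c) :
    ∑ S : X → β, piWt w S * (if ∃ x, B (S x) then 1 else 0) ≤ Fintype.card X * c := by
  have h : ∀ S : X → β, (if ∃ x, B (S x) then (1 : ℝ) else 0)
      ≤ ∑ x, if B (S x) then 1 else 0 := by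
    intro S
    have h0 : ∀ x ∈ Finset.univ, (0 : ℝ) ≤ if B (S x) then 1 else 0 := by
      intro x _
      split_ifs <;> norm_num
    split_ifs with hx
    · obtain ⟨x, hx⟩ := hx
      exact (if_pos hx).symm.le.trans (Finset.single_le_sum h0 (Finset.mem_univ x))
    · exact Finset.sum_nonneg h0
  calc _ ≤ ∑ S : X → β, piWt w S * ∑ x, (if B (S x) then 1 else 0) :=
        Finset.sum_le_sum fun S _ => mul_le_mul_of_nonneg_left (h S) (piWt_nonneg hw0 S)
    _ = ∑ x, ∑ t, w x t * (if B t then 1 else 0) := by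
        simp_rw [Finset.mul_sum]
        rw [Finset.sum_comm]
        exact Finset.sum_congr rfl fun x _ =>
          sum_piWt_apply hw x fun t => if B t then 1 else 0
    _ ≤ ∑ _x : X, c := Finset.sum_le_sum fun x _ => hc x
    _ = _ := by rw [Finset.sum_const, Finset.card_univ, nsmul_eq_mul]

lemma sum_sum_elim {X : Type*} [Fintype X] [DecidableEq X] [Fintype Q] [DecidableEq Q]
    [Fintype A] [DecidableEq A] (p : ℝ) (F : (X → Q ⊕ A → Bool) → ℝ) :
    ∑ S : X → Q ⊕ A → Bool, piWt (fun _ => listWt p) S * F S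
      = ∑ S : X → Q → Bool, ∑ S' : X → A → Bool, piWt (fun _ => listWt p) S *
          (piWt (fun _ => listWt p) S' * F fun x => Sum.elim (S x) (S' x)) := by
  rw [← Fintype.sum_prod_type']
  symm
  let e : (X → Q → Bool) × (X → A → Bool) ≃ (X → Q ⊕ A → Bool) :=
    { toFun := fun z x => Sum.elim (z.1 x) (z.2 x)
      invFun := fun S => (fun x c => S x (Sum.inl c), fun x c => S x (Sum.inr c))
      left_inv := fun z => rfl
      right_inv := fun S => by
        funext x c
        rcases c with c | c <;> rfl }
  refine Fintype.sum_equiv e _ _ fun z => ?_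
  rw [← mul_assoc]
  congr 1
  simp only [piWt, listWt, Fintype.prod_sum_type, Finset.prod_mul_distrib]
  rfl

lemma hasListColouring_of_precolouring [Fintype V] {S : V × V → Q → Bool}
    {S' : V × V → A → Bool} {g : V × V → Option Q} (hg : IsListColouring S Finset.univ g)
    {h : V × V → Option A} (hh : IsListColouring S' (uncoloured Finset.univ g) h)
    (hdef : ∀ e ∈ uncoloured Finset.univ g, h e ≠ none) :
    HasListColouring fun x => Sum.elim (S x) (S' x) := by
  have hex : ∀ e, ∃ c : Q ⊕ A, (∃ q, g e = some q ∧ c = Sum.inl q) ∨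
      ∃ a, h e = some a ∧ c = Sum.inr a := by
    intro e
    rcases hq : g e with _ | q
    · obtain ⟨a, ha⟩ := Option.ne_none_iff_exists'.1
        (hdef e (mem_uncoloured.2 ⟨Finset.mem_univ _, hq⟩))
      exact ⟨_, Or.inr ⟨a, ha, rfl⟩⟩
    · exact ⟨_, Or.inl ⟨q, rfl, rfl⟩⟩
  choose F hF using hex
  refine ⟨F, fun l e e' hl hl' heq => ?_, fun e => ?_⟩
  · rcases hF e with ⟨q, h1, h2⟩ | ⟨q, h1, h2⟩ <;> rcases hF e' with ⟨q', h1', h2'⟩ | ⟨q', h1', h2'⟩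
    · rw [h2, h2'] at heq
      cases heq
      exact hg.1 l e e' q hl hl' h1 h1'
    · rw [h2, h2'] at heq
      cases heq
    · rw [h2, h2'] at heq
      cases heq
    · rw [h2, h2'] at heq
      cases heq
      exact hh.1 l e e' q hl hl' h1 h1'
  · rcases hF e with ⟨q, h1, h2⟩ | ⟨q, h1, h2⟩
    · rw [h2]
      exact (hg.2 _ _ h1).2
    · rw [h2]
      exact (hh.2 _ _ h1).2

lemma largeList_of_not_largeList [Fintype Q] [Fintype A] {a : ℝ} {s : Q → Bool} {s' : A → Bool}
    (h : LargeList (2 * a) (Sum.elim s s')) (h' : ¬ LargeList a s') : LargeList a s := by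
  unfold LargeList at *
  have : (Finset.univ.filter fun c => Sum.elim s s' c = true).card
      = (Finset.univ.filter fun c => s c = true).card
        + (Finset.univ.filter fun c => s' c = true).card := by
    simp only [Finset.card_filter, Fintype.sum_sum_type, Sum.elim_inl, Sum.elim_inr]
    congr!
  rw [this] at h
  push_cast at h
  linarith

lemma card_le_mul_of_lineDeg_le [Fintype V] {D : Finset (V × V)} {r : ℕ}
    (hr : ∀ l, lineDeg D l ≤ r) : D.card ≤ Fintype.card V * r := by
  have h := Finset.card_le_mul_card_image (f := Prod.fst) D r (fun i _ => by
    refine le_trans (Finset.card_le_card fun e he => ?_) (hr (Sum.inl i))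
    simpa [onLine] using he)
  refine h.trans ?_
  rw [mul_comm]
  exact Nat.mul_le_mul_right _ (Finset.card_le_univ _)

/-- Summation over the lists with a prescribed set of cells with small lists. -/
lemma piWt_smallCells [Fintype V] [DecidableEq V] [Fintype A] (p a : ℝ)
    (S : V × V → A → Bool) (D : Finset (V × V)) :
    piWt (fun x s => listWt p s * if x ∈ D ↔ ¬ LargeList a s then 1 else 0) S
      = piWt (fun _ => listWt p) S * if smallCells a S = D then 1 else 0 := by
  unfold piWt
  rw [Finset.prod_mul_distrib]
  congr 1
  by_cases h : smallCells a S = D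
  · rw [if_pos h]
    refine Finset.prod_eq_one fun x _ => if_pos ?_
    rw [← h, mem_smallCells]
  · rw [if_neg h]
    obtain ⟨x, hx⟩ : ∃ x, ¬ (x ∈ D ↔ ¬ LargeList a (S x)) := by
      by_contra! hcon
      exact h (Finset.ext fun x => by rw [hcon x, mem_smallCells])
    exact Finset.prod_eq_zero (Finset.mem_univ x) (if_neg hx)

lemma sum_no_completion_smallCells_le [Fintype V] [DecidableEq V] [Fintype A] [DecidableEq A]
    {p : ℝ} (hp : p ∈ Set.Icc (0 : ℝ) 1) {a b : ℝ} (hb : 0 ≤ b) {R : ℕ}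
    (hsmall : ∀ Fb : Finset A, Fb.card ≤ 2 * R → ListAvoids (largeWt p a) b Fb)
    (Pre : Finset (V × V) → Finset (V × V) → Prop)
    (hPre : ∀ D U, Pre D U → (∀ e ∈ U, e ∉ D) ∧ ∀ l, lineDeg U l ≤ R)
    (g : Finset (V × V) → Finset (V × V)) :
    ∑ S : V × V → A → Bool, piWt (fun _ => listWt p) S *
        (if Pre (smallCells a S) (g (smallCells a S)) ∧
          ¬ ∃ h, IsListColouring S (g (smallCells a S)) h ∧ ∀ e ∈ g (smallCells a S), h e ≠ none
          then 1 else 0)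
      ≤ Fintype.card (V × V) * b := by
  let w : Finset (V × V) → V × V → (A → Bool) → ℝ := fun D x s =>
    listWt p s * if x ∈ D ↔ ¬ LargeList a s then 1 else 0
  have hw : ∀ D x s, 0 ≤ w D x s := by
    intro D x s
    refine mul_nonneg (listWt_nonneg hp s) ?_
    split_ifs <;> norm_num
  have hsplit : ∀ f : Finset (V × V) → (V × V → A → Bool) → ℝ,
      ∑ S : V × V → A → Bool, piWt (fun _ => listWt p) S * f (smallCells a S) S
        = ∑ D, ∑ S : V × V → A → Bool, piWt (w D) S * f D S := by
    intro f
    rw [Finset.sum_comm]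
    refine Finset.sum_congr rfl fun S _ => ?_
    rw [Finset.sum_eq_single (smallCells a S)]
    · simp only [w, piWt_smallCells, if_true, mul_one]
    · intro D _ hD
      simp only [w, piWt_smallCells, if_neg (Ne.symm hD), mul_zero, zero_mul]
    · simp
  rw [hsplit fun D S => if Pre D (g D) ∧
    ¬ ∃ h, IsListColouring S (g D) h ∧ ∀ e ∈ g D, h e ≠ none then 1 else 0]
  have hD : ∀ D, ∑ S : V × V → A → Bool, piWt (w D) S *
      (if Pre D (g D) ∧ ¬ ∃ h, IsListColouring S (g D) h ∧ ∀ e ∈ g D, h e ≠ none then 1 else 0)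
        ≤ Fintype.card (V × V) * b * ∑ S : V × V → A → Bool, piWt (w D) S := by
    intro D
    have hnn : 0 ≤ ∑ S : V × V → A → Bool, piWt (w D) S :=
      Finset.sum_nonneg fun S _ => piWt_nonneg (hw D) S
    by_cases hpre : Pre D (g D)
    · refine le_trans (Finset.sum_le_sum fun S _ => mul_le_mul_of_nonneg_left ?_
        (piWt_nonneg (hw D) S)) ((sum_no_completion_le (w D) (hw D) hb (hPre _ _ hpre).2
          (fun x hx Fb hFb => ?_)).trans (mul_le_mul_of_nonneg_right
            (mul_le_mul_of_nonneg_right ?_ hb) hnn))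
      · by_cases hc : ∃ h, IsListColouring S (g D) h ∧ ∀ e ∈ g D, h e ≠ none
        · rw [if_pos hc, if_neg fun h => h.2 hc]
        · rw [if_neg hc]
          split_ifs <;> norm_num
      · have : w D x = largeWt p a := by
          funext s
          simp only [w, largeWt, (hPre _ _ hpre).1 x hx, false_iff, not_not]
        rw [this]
        exact hsmall Fb hFb
      · exact_mod_cast Finset.card_le_univ _
    · simp only [hpre, false_and, if_false, mul_zero, Finset.sum_const_zero]
      positivity
  refine (Finset.sum_le_sum fun D _ => hD D).trans ?_
  rw [← Finset.mul_sum]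
  have h1 := hsplit fun _ _ => 1
  simp only [mul_one] at h1
  rw [← h1, sum_piWt_eq_one fun _ => sum_listWt p, mul_one]

lemma sum_exists_not_largeList_le {X C : Type*} [Fintype X] [DecidableEq X] [Fintype C]
    [DecidableEq C] {p a β : ℝ} (hp : p ∈ Set.Icc (0 : ℝ) 1)
    (h : ∑ s : C → Bool, listWt p s * (if LargeList a s then 0 else 1) ≤ β) :
    ∑ S : X → C → Bool, piWt (fun _ => listWt p) S *
      (if ∃ x, ¬ LargeList a (S x) then 1 else 0) ≤ Fintype.card X * β := by
  have h' : ∑ s : C → Bool, listWt p s * (if ¬ LargeList a s then 1 else 0) ≤ β := by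
    simpa only [ite_not] using h
  have := sum_piWt_exists_le (w := fun _ : X => listWt p) (fun _ => listWt_nonneg hp)
    (fun _ => sum_listWt p) (fun s => ¬ LargeList a s) fun _ => by convert h'
  convert this

/-- The main estimate: the probability that there is no proper colouring from random lists. -/
lemma sum_no_listColouring_le [Fintype V] [DecidableEq V] [Fintype Q] [DecidableEq Q]
    [Fintype A] [DecidableEq A] {p : ℝ}
    (hp : p ∈ Set.Icc (0 : ℝ) 1) {ρ : ℝ} (hρ : 0 ≤ ρ) {rB r T r' : ℕ}
    (hstep : ∀ U, (2 : ℝ) ^ rB ≤ potential U → ∑ m : V × V → Bool, piWt (fun _ => bern p) m *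
      potential (U \ pickMatching U (U.filter fun x => m x = true)) ≤ ρ * potential U)
    (hT : 0 < T) (hr' : Fintype.card V * r ≤ T * r') {a b β₁ β₂ : ℝ} (hb : 0 ≤ b)
    (hQ : ∀ Fb : Finset Q, Fb.card ≤ 2 * r + 2 * r' → ListAvoids (largeWt p a) b Fb)
    (hA : ∀ Fb : Finset A, Fb.card ≤ 2 * (rB + r + T) → ListAvoids (largeWt p a) b Fb)
    (h₁ : ∑ s : Q ⊕ A → Bool, listWt p s * (if LargeList (2 * a) s then 0 else 1) ≤ β₁)
    (h₂ : ∑ S : V × V → A → Bool, piWt (fun _ => listWt p) S *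
      (if ∀ l, lineDeg (smallCells a S) l ≤ r then 0 else 1) ≤ β₂) :
    ∑ S : V × V → Q ⊕ A → Bool, piWt (fun _ => listWt p) S *
        (if HasListColouring S then 0 else 1)
      ≤ Fintype.card (V × V) * β₁ + β₂ +
        (ρ ^ Fintype.card Q * (2 * Fintype.card V * 2 ^ Fintype.card V)
          + Fintype.card (V × V) * b) + Fintype.card (V × V) * b := by
  set R := rB + r + T with hR
  let E₃ : (V × V → Q → Bool) → (V × V → A → Bool) → Prop := fun S S' =>
    (∀ l, lineDeg (smallCells a S') l ≤ r) ∧ (∀ x ∈ smallCells a S', LargeList a (S x)) ∧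
      ¬ ∃ g, IsPrecolouring S (smallCells a S') R g
  let G : (V × V → Q → Bool) → Finset (V × V) → V × V → Option Q := fun S D =>
    Classical.epsilon (IsPrecolouring S D R)
  let E₄ : (V × V → Q → Bool) → (V × V → A → Bool) → Prop := fun S S' =>
    IsPrecolouring S (smallCells a S') R (G S (smallCells a S')) ∧
      ¬ ∃ h, IsListColouring S' (uncoloured Finset.univ (G S (smallCells a S'))) h ∧
        ∀ e ∈ uncoloured Finset.univ (G S (smallCells a S')), h e ≠ none
  have hpt : ∀ (S : V × V → Q → Bool) (S' : V × V → A → Bool),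
      (if HasListColouring fun x => Sum.elim (S x) (S' x) then (0 : ℝ) else 1)
        ≤ (if ∃ x, ¬ LargeList (2 * a) (Sum.elim (S x) (S' x)) then 1 else 0)
          + (if ∀ l, lineDeg (smallCells a S') l ≤ r then 0 else 1)
          + (if E₃ S S' then 1 else 0) + (if E₄ S S' then 1 else 0) := by
    intro S S'
    have h01 : ∀ (P : Prop) [Decidable P], (0 : ℝ) ≤ if P then 1 else 0 := by
      intro P _
      split_ifs <;> norm_num
    have h10 : ∀ (P : Prop) [Decidable P], (0 : ℝ) ≤ if P then 0 else 1 := by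
      intro P _
      split_ifs <;> norm_num
    by_cases hS : HasListColouring fun x => Sum.elim (S x) (S' x)
    · rw [if_pos hS]
      linarith [h01 (∃ x, ¬ LargeList (2 * a) (Sum.elim (S x) (S' x))),
        h10 (∀ l, lineDeg (smallCells a S') l ≤ r), h01 (E₃ S S'), h01 (E₄ S S')]
    rw [if_neg hS]
    by_cases e1 : ∃ x, ¬ LargeList (2 * a) (Sum.elim (S x) (S' x))
    · rw [if_pos e1]
      linarith [h10 (∀ l, lineDeg (smallCells a S') l ≤ r), h01 (E₃ S S'), h01 (E₄ S S')]
    by_cases e2 : ∀ l, lineDeg (smallCells a S') l ≤ r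
    · by_cases e3 : ∃ g, IsPrecolouring S (smallCells a S') R g
      · have e4 : E₄ S S' := by
          have hspec : IsPrecolouring S (smallCells a S') R (G S (smallCells a S')) :=
            Classical.epsilon_spec e3
          refine ⟨hspec, ?_⟩
          rintro ⟨h, hh, hdef⟩
          exact hS (hasListColouring_of_precolouring hspec.1 hh hdef)
        rw [if_pos e4]
        linarith [h01 (∃ x, ¬ LargeList (2 * a) (Sum.elim (S x) (S' x))),
          h10 (∀ l, lineDeg (smallCells a S') l ≤ r), h01 (E₃ S S')]
      · have e3' : E₃ S S' := by
          refine ⟨e2, fun x hx => ?_, e3⟩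
          push Not at e1
          exact largeList_of_not_largeList (e1 x) (mem_smallCells.1 hx)
        rw [if_pos e3']
        linarith [h01 (∃ x, ¬ LargeList (2 * a) (Sum.elim (S x) (S' x))),
          h10 (∀ l, lineDeg (smallCells a S') l ≤ r), h01 (E₄ S S')]
    · rw [if_neg e2]
      linarith [h01 (∃ x, ¬ LargeList (2 * a) (Sum.elim (S x) (S' x))), h01 (E₃ S S'),
        h01 (E₄ S S')]
  have hwQ : ∀ S : V × V → Q → Bool, 0 ≤ piWt (fun _ => listWt p) S :=
    piWt_nonneg fun _ => listWt_nonneg hp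
  have hwA : ∀ S : V × V → A → Bool, 0 ≤ piWt (fun _ => listWt p) S :=
    piWt_nonneg fun _ => listWt_nonneg hp
  have hsQ : ∑ S : V × V → Q → Bool, piWt (fun _ => listWt p) S = 1 :=
    sum_piWt_eq_one fun _ => sum_listWt p
  have hsA : ∑ S : V × V → A → Bool, piWt (fun _ => listWt p) S = 1 :=
    sum_piWt_eq_one fun _ => sum_listWt p
  have b1 : ∑ S : V × V → Q → Bool, ∑ S' : V × V → A → Bool, piWt (fun _ => listWt p) S *
      (piWt (fun _ => listWt p) S' *
        (if ∃ x, ¬ LargeList (2 * a) (Sum.elim (S x) (S' x)) then 1 else 0))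
      ≤ Fintype.card (V × V) * β₁ := by
    rw [← sum_sum_elim p fun S : V × V → Q ⊕ A → Bool =>
      if ∃ x, ¬ LargeList (2 * a) (S x) then 1 else 0]
    convert sum_exists_not_largeList_le (X := V × V) hp h₁
  have b2 : ∑ S : V × V → Q → Bool, ∑ S' : V × V → A → Bool, piWt (fun _ => listWt p) S *
      (piWt (fun _ => listWt p) S' *
        (if ∀ l, lineDeg (smallCells a S') l ≤ r then 0 else 1)) ≤ β₂ := by
    simp_rw [← Finset.mul_sum]
    rw [← Finset.sum_mul, hsQ, one_mul]
    exact h₂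
  have b3 : ∑ S : V × V → Q → Bool, ∑ S' : V × V → A → Bool, piWt (fun _ => listWt p) S *
      (piWt (fun _ => listWt p) S' * (if E₃ S S' then 1 else 0))
      ≤ ρ ^ Fintype.card Q * (2 * Fintype.card V * 2 ^ Fintype.card V)
          + Fintype.card (V × V) * b := by
    rw [Finset.sum_comm]
    have hin : ∀ S' : V × V → A → Bool, ∑ S : V × V → Q → Bool, piWt (fun _ => listWt p) S *
        (piWt (fun _ => listWt p) S' * (if E₃ S S' then 1 else 0))
        ≤ piWt (fun _ => listWt p) S' *
          (ρ ^ Fintype.card Q * (2 * Fintype.card V * 2 ^ Fintype.card V)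
            + Fintype.card (V × V) * b) := by
      intro S'
      simp_rw [mul_left_comm (piWt (fun _ => listWt p) _ : ℝ) (piWt (fun _ => listWt p) S')]
      rw [← Finset.mul_sum]
      refine mul_le_mul_of_nonneg_left ?_ (hwA S')
      by_cases hd : ∀ l, lineDeg (smallCells a S') l ≤ r
      · simp only [E₃, hd, implies_true, true_and]
        refine (sum_no_precolouring_le hp hρ hstep hd hT
          ((card_le_mul_of_lineDeg_le hd).trans hr') hb hQ).trans ?_
        gcongr
        exact Finset.card_le_univ _
      · simp only [E₃, hd, false_and, if_false, mul_zero, Finset.sum_const_zero]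
        positivity
    refine (Finset.sum_le_sum fun S' _ => hin S').trans ?_
    rw [← Finset.sum_mul, hsA, one_mul]
  have b4 : ∑ S : V × V → Q → Bool, ∑ S' : V × V → A → Bool, piWt (fun _ => listWt p) S *
      (piWt (fun _ => listWt p) S' * (if E₄ S S' then 1 else 0))
      ≤ Fintype.card (V × V) * b := by
    have hin : ∀ S : V × V → Q → Bool, ∑ S' : V × V → A → Bool, piWt (fun _ => listWt p) S *
        (piWt (fun _ => listWt p) S' * (if E₄ S S' then 1 else 0))
        ≤ piWt (fun _ => listWt p) S * (Fintype.card (V × V) * b) := by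
      intro S
      rw [← Finset.mul_sum]
      refine mul_le_mul_of_nonneg_left ?_ (hwQ S)
      refine le_trans (Finset.sum_le_sum fun S' _ => mul_le_mul_of_nonneg_left ?_ (hwA S'))
        (sum_no_completion_smallCells_le hp hb hA
        (fun D U => (∀ e ∈ U, e ∉ D) ∧ ∀ l, lineDeg U l ≤ R) (fun _ _ h => h)
        (fun D => uncoloured Finset.univ (G S D)))
      by_cases h4 : E₄ S S'
      · rw [if_pos h4, if_pos]
        refine ⟨⟨fun e he heD => ?_, h4.1.2.2⟩, h4.2⟩
        exact h4.1.2.1 e heD (mem_uncoloured.1 he).2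
      · rw [if_neg h4]
        split_ifs <;> norm_num
    refine (Finset.sum_le_sum fun S _ => hin S).trans ?_
    rw [← Finset.sum_mul, hsQ, one_mul]
  rw [sum_sum_elim]
  refine le_trans (Finset.sum_le_sum fun S _ => Finset.sum_le_sum fun S' _ =>
    mul_le_mul_of_nonneg_left (mul_le_mul_of_nonneg_left (hpt S S') (hwA S')) (hwQ S)) ?_
  simp_rw [mul_add, Finset.sum_add_distrib]
  linarith

end Combination

/-! ### Tail bounds for the random lists -/

section Tails

variable {V C : Type*}

lemma listAvoids_of_card_le [Fintype C] [DecidableEq C] {p : ℝ} (hp : p ∈ Set.Icc (0 : ℝ) 1)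
    {a b t M : ℝ} (ht : 0 ≤ t) {Fb : Finset C} (hM : (Fb.card : ℝ) ≤ M)
    (hhalf : ∑ s : C → Bool, listWt p s * (if LargeList a s then 0 else 1) ≤ 1 / 2)
    (hb : Real.exp (M * (p * (Real.exp t - 1)) - t * a) ≤ b) :
    ListAvoids (largeWt p a) (2 * b) Fb := by
  have hlarge : (1 : ℝ) / 2 ≤ ∑ s : C → Bool, largeWt p a s := by
    have h : ∀ s : C → Bool, largeWt p a s
        = listWt p s - listWt p s * (if LargeList a s then 0 else 1) := by
      intro s
      unfold largeWt
      split_ifs <;> ring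
    rw [Finset.sum_congr rfl fun s _ => h s, Finset.sum_sub_distrib, sum_listWt]
    linarith
  have hb0 : 0 ≤ b := (Real.exp_pos _).le.trans hb
  have hmain : ∑ s : C → Bool, largeWt p a s * (if ∀ c, s c = true → c ∈ Fb then 1 else 0)
      ≤ b := by
    have h1 := sum_listWt_exp_card_le hp Fb t
    have het : 0 ≤ p * (Real.exp t - 1) :=
      mul_nonneg hp.1 (by linarith [Real.add_one_le_exp t])
    have h2 : Real.exp (Fb.card * (p * (Real.exp t - 1))) ≤ b * Real.exp (t * a) := by
      rw [← div_le_iff₀ (Real.exp_pos _), ← Real.exp_sub]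
      refine le_trans (Real.exp_le_exp.2 ?_) hb
      gcongr
    refine le_of_mul_le_mul_right (a := Real.exp (t * a)) ?_ (Real.exp_pos _)
    refine le_trans ?_ (h1.trans h2)
    rw [Finset.sum_mul]
    refine Finset.sum_le_sum fun s _ => ?_
    have h0 := listWt_nonneg hp s
    by_cases hs : (∀ c, s c = true → c ∈ Fb) ∧ LargeList a s
    · rw [if_pos hs.1, mul_one, largeWt, if_pos hs.2, mul_one]
      have : (Finset.univ.filter fun c => s c = true) = Fb.filter fun c => s c = true := by
        ext c
        simpa using hs.1 c
      have hl := hs.2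
      rw [LargeList, this] at hl
      gcongr
    · refine le_trans (le_of_eq ?_) (mul_nonneg h0 (Real.exp_pos _).le)
      rw [not_and_or] at hs
      rcases hs with hs | hs
      · rw [if_neg hs, mul_zero, zero_mul]
      · rw [largeWt, if_neg hs, mul_zero, zero_mul, zero_mul]
  refine hmain.trans ?_
  nlinarith

lemma sum_not_largeList_le [Fintype C] [DecidableEq C] {p : ℝ} (hp : p ∈ Set.Icc (0 : ℝ) 1)
    {t : ℝ} (ht : 0 ≤ t) (a : ℝ) :
    ∑ s : C → Bool, listWt p s * (if LargeList a s then 0 else 1)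
      ≤ Real.exp (Fintype.card C * (p * (Real.exp (-t) - 1)) + t * a) := by
  refine le_trans (le_of_eq (Finset.sum_congr rfl fun s _ => ?_)) (sum_listWt_card_lt_le hp ht a)
  rw [LargeList]
  split_ifs with h h' h'
  · exact absurd h' (not_lt.2 h)
  · rw [mul_zero]
  · rw [mul_one]
  · exact absurd (not_lt.1 h') h

lemma sum_lineDeg_smallCells_gt_le [Fintype V] [DecidableEq V] [Fintype C] [DecidableEq C]
    {p : ℝ} (hp : p ∈ Set.Icc (0 : ℝ) 1) {a δ : ℝ}
    (hδ : ∑ s : C → Bool, listWt p s * (if LargeList a s then 0 else 1) ≤ δ) (r : ℕ) :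
    ∑ S : V × V → C → Bool, piWt (fun _ => listWt p) S *
        (if ∀ l, lineDeg (smallCells a S) l ≤ r then 0 else 1)
      ≤ 2 * Fintype.card V *
        Real.exp (Fintype.card V * (δ * (Real.exp 1 - 1)) - (r + 1)) := by
  have hw : ∀ S : V × V → C → Bool, 0 ≤ piWt (fun _ => listWt p) S :=
    piWt_nonneg fun _ => listWt_nonneg hp
  have hline : ∀ l : V ⊕ V, ∑ S : V × V → C → Bool, piWt (fun _ => listWt p) S *
      (if lineDeg (smallCells a S) l ≤ r then 0 else 1)
      ≤ Real.exp (Fintype.card V * (δ * (Real.exp 1 - 1)) - (r + 1)) := by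
    intro l
    have h := sum_piWt_card_ge_le (X := V × V) (fun _ => listWt (C := C) p)
      (fun _ => listWt_nonneg hp) (fun _ => sum_listWt p) (fun s => ¬ LargeList a s)
      (∑ s with ¬ LargeList a s, listWt p s) (Finset.univ.filter (onLine l))
      (fun _ _ => rfl) zero_le_one (r + 1)
    have hsum : ∑ s : C → Bool with ¬ LargeList a s, listWt p s
        = ∑ s : C → Bool, listWt p s * (if LargeList a s then 0 else 1) := by
      rw [Finset.sum_filter]
      refine Finset.sum_congr rfl fun s _ => ?_
      split_ifs <;> simp
    refine le_trans (le_of_eq (Finset.sum_congr rfl fun S _ => ?_)) (h.trans ?_)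
    · have hS : ((Finset.univ.filter (onLine l)).filter fun x => ¬ LargeList a (S x))
          = (smallCells a S).filter (onLine l) := by
        ext x
        simp [mem_smallCells, and_comm]
      have hc : ((r : ℝ) + 1 ≤ (((Finset.univ.filter (onLine l)).filter
          fun x => ¬ LargeList a (S x)).card : ℝ)) ↔ ¬ lineDeg (smallCells a S) l ≤ r := by
        rw [hS, not_le, lineDeg]
        norm_cast
      by_cases hd : lineDeg (smallCells a S) l ≤ r
      · rw [if_pos hd, mul_zero, if_neg fun h => hc.1 h hd]
      · rw [if_neg hd, mul_one, if_pos (hc.2 hd)]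
    · rw [hsum, one_mul]
      have hcard : ((Finset.univ.filter (onLine l)).card : ℝ) ≤ Fintype.card V := by
        exact_mod_cast lineDeg_le_card (Finset.univ : Finset (V × V)) l
      have he : 0 ≤ Real.exp 1 - 1 := by linarith [Real.add_one_le_exp 1]
      have hδ0 : 0 ≤ ∑ s : C → Bool, listWt p s * (if LargeList a s then 0 else 1) :=
        Finset.sum_nonneg fun s _ => mul_nonneg (listWt_nonneg hp s) (by split_ifs <;> norm_num)
      gcongr
  calc _ ≤ ∑ S : V × V → C → Bool, piWt (fun _ => listWt p) S *
        ∑ l, (if lineDeg (smallCells a S) l ≤ r then 0 else 1) := by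
        refine Finset.sum_le_sum fun S _ => mul_le_mul_of_nonneg_left ?_ (hw S)
        have h0 : ∀ l ∈ Finset.univ, (0 : ℝ) ≤ if lineDeg (smallCells a S) l ≤ r then 0 else 1 := by
          intro l _
          split_ifs <;> norm_num
        split_ifs with hl
        · exact Finset.sum_nonneg h0
        · push Not at hl
          obtain ⟨l, hl⟩ := hl
          exact (if_neg (not_le.2 hl)).symm.le.trans (Finset.single_le_sum h0 (Finset.mem_univ l))
    _ = ∑ l, ∑ S : V × V → C → Bool, piWt (fun _ => listWt p) S *
        (if lineDeg (smallCells a S) l ≤ r then 0 else 1) := by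
        simp_rw [Finset.mul_sum]
        rw [Finset.sum_comm]
    _ ≤ ∑ _l : V ⊕ V, Real.exp (Fintype.card V * (δ * (Real.exp 1 - 1)) - (r + 1)) :=
        Finset.sum_le_sum fun l _ => hline l
    _ = _ := by
        rw [Finset.sum_const, Finset.card_univ, Fintype.card_sum, nsmul_eq_mul]
        push_cast
        ring

lemma sum_piWt_potential_step_le_of_le [Fintype V] [DecidableEq V] {p : ℝ}
    (hp : p ∈ Set.Icc (0 : ℝ) 1) (hp0 : 0 < p) {ξ d : ℝ} (hξ : 0 < ξ) (hξ1 : ξ ≤ 1 / 2)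
    (hd : 0 < d) (h1 : Real.exp (ξ / 2 - ξ ^ 2 / 4 * (d * p)) ≤ ξ)
    (h2 : 2 * Fintype.card V ≤ ξ * (2 : ℝ) ^ (ξ * d)) {R : ℕ} (hR : d ≤ R)
    (U : Finset (V × V)) (hU : (2 : ℝ) ^ R ≤ potential U) :
    ∑ m : V × V → Bool, piWt (fun _ => bern p) m *
        potential (U \ pickMatching U (U.filter fun x => m x = true))
      ≤ (1 - (1 - 2 * ξ) * (1 - ξ) ^ 2 / (2 * (1 + ξ))) * potential U := by
  have hpos : 0 < potential U := lt_of_lt_of_le (by positivity) hU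
  have hD : (2 : ℝ) ^ Real.logb 2 (potential U) = potential U :=
    Real.rpow_logb (by norm_num) (by norm_num) hpos
  have hdD : d ≤ Real.logb 2 (potential U) := by
    refine hR.trans ((Real.le_logb_iff_rpow_le (by norm_num) hpos).2 ?_)
    rwa [Real.rpow_natCast]
  set D := Real.logb 2 (potential U) with hD_def
  refine sum_piWt_potential_step_le hp hp0 U (t := ξ / 2) (by linarith) hξ hξ1 (hd.trans_le hdD)
    hD (le_trans (Real.exp_le_exp.2 ?_) h1) ?_
  · have he : Real.exp (ξ / 2) - 1 ≤ ξ / 2 + (ξ / 2) ^ 2 := by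
      have := (abs_le.1 (Real.abs_exp_sub_one_sub_id_le (x := ξ / 2)
        (by rw [abs_le]; constructor <;> linarith))).2
      linarith
    have hDp : d * p ≤ D * p := by gcongr
    have hDp0 : 0 ≤ D * p := (by positivity : 0 ≤ d * p).trans hDp
    have h3 : D * (p * (Real.exp (ξ / 2) - 1)) ≤ D * p * (ξ / 2 + (ξ / 2) ^ 2) := by
      rw [← mul_assoc]
      gcongr
    have h4 : ξ ^ 2 / 4 * (d * p) ≤ ξ ^ 2 / 4 * (D * p) := by gcongr
    nlinarith
  · have hsplit : (2 : ℝ) ^ D = 2 ^ ((1 - ξ) * D) * 2 ^ (ξ * D) := by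
      rw [← Real.rpow_add (by norm_num)]
      ring_nf
    rw [hsplit]
    have h5 : (2 : ℝ) ^ (ξ * d) ≤ 2 ^ (ξ * D) :=
      Real.rpow_le_rpow_of_exponent_le (by norm_num) (by gcongr)
    have h6 : 0 < (2 : ℝ) ^ ((1 - ξ) * D) := by positivity
    calc 2 * (Fintype.card V : ℝ) * 2 ^ ((1 - ξ) * D)
        ≤ ξ * 2 ^ (ξ * d) * 2 ^ ((1 - ξ) * D) := by gcongr
      _ ≤ ξ * 2 ^ (ξ * D) * 2 ^ ((1 - ξ) * D) := by gcongr
      _ = _ := by ring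

end Tails

/-! ### Choice of the parameters -/

lemma step_factor_nonneg {ξ : ℝ} (hξ : 0 < ξ) (hξ₁ : ξ ≤ 1 / 2) :
    0 ≤ 1 - (1 - 2 * ξ) * (1 - ξ) ^ 2 / (2 * (1 + ξ)) := by
  have h : (1 - 2 * ξ) * (1 - ξ) ^ 2 ≤ 1 * 1 :=
    mul_le_mul (by linarith) (by nlinarith) (sq_nonneg _) zero_le_one
  rw [sub_nonneg, div_le_one (by positivity)]
  linarith

lemma sum_no_listColouring_le_of_parameters {ε η c lam a₀ t φ ξ L p : ℝ} {n q m : ℕ}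
    (hc : 0 < c) (hcε : c * (1 + ε) = 2 * (1 + η))
    (hlam : 0 < lam) (hlamη : 1 + η / 2 ≤ (1 + η) * (1 - Real.exp (-lam)))
    (ha₁ : 4 * lam * a₀ ≤ η) (ha₂ : a₀ ≤ ε * c / 16) (ha₃ : a₀ ≤ c / 4)
    (ht : 0 ≤ t) (hta : t * a₀ = 4) (hφ₀ : 0 < φ) (hφ₁ : φ ≤ 1)
    (hφ : φ * (c * (Real.exp t - 1)) ≤ 1) (hξ : 0 < ξ) (hξ₁ : ξ ≤ 1 / 2)
    (hL : Real.exp L = n) (hL₀ : 0 < L) (hpn : p * n = c * L) (hp₁ : p ≤ 1)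
    (hq : n ≤ q) (hm : ε / 4 * n ≤ m) (hqm : (1 + ε) * n ≤ q + m)
    (h₁ : Real.exp (-(ε * c / 16 * L)) ≤ 1 / 2) (h₂ : Real.exp (-(c / 4 * L)) ≤ 1 / 2)
    (h₃ : Real.exp (-(ε * c / 16 * L)) * (Real.exp 1 - 1) ≤ φ ^ 2 / 160)
    (h₄ : 100 ≤ φ * n) (h₅ : Real.exp (ξ / 2 - ξ ^ 2 / 4 * (φ / 16 * (c * L))) ≤ ξ)
    (h₆ : 2 * n ≤ ξ * (2 : ℝ) ^ (ξ * (φ / 16 * n))) :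
    ∑ S : Fin n × Fin n → Fin q ⊕ Fin m → Bool, piWt (fun _ => listWt p) S *
        (if HasListColouring S then 0 else 1)
      ≤ Real.exp (-(η / 2 * L)) + 2 * n * Real.exp (-(φ ^ 2 / 160 * n)) +
        ((1 - (1 - 2 * ξ) * (1 - ξ) ^ 2 / (2 * (1 + ξ))) ^ q * (2 * n * 2 ^ n)
          + 2 * Real.exp (-L)) + 2 * Real.exp (-L) := by
  have hn : (0 : ℝ) < n := hL ▸ Real.exp_pos L
  have hp₀ : 0 < p := pos_of_mul_pos_left (hpn ▸ by positivity) hn.le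
  have hp : p ∈ Set.Icc (0 : ℝ) 1 := ⟨hp₀.le, hp₁⟩
  have hn2 : ∀ x, (Fintype.card (Fin n × Fin n) : ℝ) * Real.exp x = Real.exp (2 * L + x) := by
    intro x
    rw [Real.exp_add, two_mul, Real.exp_add, hL, Fintype.card_prod, Fintype.card_fin]
    push_cast
    ring
  have hexp : Real.exp (-1) - 1 ≤ -(1 / 2) := by
    have := Real.exp_neg_one_lt_half
    linarith
  have tail : ∀ {C : Type} [Fintype C] [DecidableEq C] (κ : ℝ), κ * n ≤ Fintype.card C →
      ∀ x, a₀ - κ * c / 2 ≤ -x → ∑ s : C → Bool, listWt p s *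
        (if LargeList (a₀ * L) s then 0 else 1) ≤ Real.exp (-(x * L)) := by
    intro C _ _ κ hκ x hx
    refine (sum_not_largeList_le hp zero_le_one _).trans (Real.exp_le_exp.2 ?_)
    have e1 : κ * (c * L) ≤ Fintype.card C * p := by
      rw [← hpn, show κ * (p * n) = κ * n * p by ring]
      gcongr
    have e2 : (Fintype.card C : ℝ) * (p * (Real.exp (-1) - 1))
        ≤ Fintype.card C * p * -(1 / 2) := by
      rw [← mul_assoc]
      gcongr
    have e3 : (a₀ - κ * c / 2) * L ≤ -x * L := by gcongr
    linarith
  have tailA := tail (C := Fin m) (ε / 4) (by simpa using hm) (ε * c / 16) (by linarith)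
  have tailQ := tail (C := Fin q) 1 (by simpa using hq) (c / 4) (by linarith)
  have avoid : ∀ {C : Type} [Fintype C] [DecidableEq C],
      ∑ s : C → Bool, listWt p s * (if LargeList (a₀ * L) s then 0 else 1) ≤ 1 / 2 →
      ∀ Fb : Finset C, (Fb.card : ℝ) ≤ φ * n →
        ListAvoids (largeWt p (a₀ * L)) (2 * Real.exp (-(3 * L))) Fb := by
    intro C _ _ hC Fb hFb
    refine listAvoids_of_card_le hp ht hFb hC (Real.exp_le_exp.2 ?_)
    have e1 : φ * n * (p * (Real.exp t - 1)) = φ * (c * (Real.exp t - 1)) * L := by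
      linear_combination (φ * (Real.exp t - 1)) * hpn
    have e2 : φ * (c * (Real.exp t - 1)) * L ≤ 1 * L := by gcongr
    rw [e1, ← mul_assoc t, hta]
    linarith
  have f₁ := Nat.floor_le (a := φ / 8 * n) (by positivity)
  have f₁' := Nat.lt_floor_add_one (φ / 8 * n)
  have f₂ := Nat.floor_le (a := φ ^ 2 / 80 * n) (by positivity)
  have f₂' := Nat.lt_floor_add_one (φ ^ 2 / 80 * n)
  have f₃ := Nat.floor_le (a := φ / 4 * n) (by positivity)
  have f₃' := Nat.lt_floor_add_one (φ / 4 * n)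
  have hφn : φ ^ 2 * n ≤ φ * n := by
    rw [sq, mul_assoc]
    exact mul_le_of_le_one_left (by positivity) hφ₁
  set R := ⌊φ / 8 * n⌋₊ with hR
  set r := ⌊φ ^ 2 / 80 * n⌋₊ with hr
  set r' := ⌊φ / 4 * n⌋₊ with hr'
  have hR_pos : 0 < R := by
    have : (0 : ℝ) < R := by linarith
    exact_mod_cast this
  have hmain := sum_no_listColouring_le (V := Fin n) (Q := Fin q) (A := Fin m) hp
    (ρ := 1 - (1 - 2 * ξ) * (1 - ξ) ^ 2 / (2 * (1 + ξ))) ?_ (rB := R) (r := r) (T := R)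
    (r' := r') (a := a₀ * L) (b := 2 * Real.exp (-(3 * L)))
    (β₁ := Real.exp (-((2 + η / 2) * L))) (β₂ := 2 * n * Real.exp (-(φ ^ 2 / 160 * n)))
    ?_ hR_pos ?_ (by positivity) ?_ ?_ ?_ ?_
  · refine hmain.trans (le_of_eq ?_)
    rw [mul_left_comm _ (2 : ℝ), hn2, hn2, Fintype.card_fin, Fintype.card_fin]
    ring_nf
  · exact step_factor_nonneg hξ hξ₁
  · refine sum_piWt_potential_step_le_of_le hp hp₀ hξ hξ₁ (d := φ / 16 * n) (by positivity)
      ?_ ?_ (by linarith)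
    · rwa [show φ / 16 * n * p = φ / 16 * (c * L) by rw [← hpn]; ring]
    · rwa [Fintype.card_fin]
  · rw [Fintype.card_fin]
    have e1 : φ / 10 * n ≤ R := by linarith
    have e2 : φ / 8 * n ≤ r' := by linarith
    have e3 : φ / 10 * n * (φ / 8 * n) ≤ R * r' := by gcongr
    have e4 : (n : ℝ) * r ≤ n * (φ ^ 2 / 80 * n) := by gcongr
    have : (n : ℝ) * r ≤ R * r' := by nlinarith
    exact_mod_cast this
  · intro Fb hFb
    refine avoid (tailQ.trans h₂) Fb ?_
    have : (Fb.card : ℝ) ≤ 2 * r + 2 * r' := by exact_mod_cast hFb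
    linarith
  · intro Fb hFb
    refine avoid (tailA.trans h₁) Fb ?_
    have : (Fb.card : ℝ) ≤ 2 * (R + r + R) := by exact_mod_cast hFb
    linarith
  · refine (sum_not_largeList_le hp hlam.le _).trans (Real.exp_le_exp.2 ?_)
    rw [Fintype.card_sum, Fintype.card_fin, Fintype.card_fin]
    push_cast
    have hlam1 : 0 ≤ 1 - Real.exp (-lam) := by
      have : Real.exp (-lam) ≤ 1 := Real.exp_le_one_iff.2 (by linarith)
      linarith
    have e1 : (1 + ε) * n * (p * (1 - Real.exp (-lam)))
        ≤ (q + m) * (p * (1 - Real.exp (-lam))) := by gcongr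
    have e2 : (1 + ε) * n * (p * (1 - Real.exp (-lam)))
        = 2 * ((1 + η) * (1 - Real.exp (-lam))) * L := by
      linear_combination ((1 + ε) * (1 - Real.exp (-lam))) * hpn
        + (L * (1 - Real.exp (-lam))) * hcε
    have e3 : 2 * (1 + η / 2) * L ≤ 2 * ((1 + η) * (1 - Real.exp (-lam))) * L := by gcongr
    have e4 : 4 * lam * a₀ * L ≤ η * L := by gcongr
    linarith
  · refine (sum_lineDeg_smallCells_gt_le hp tailA r).trans ?_
    rw [Fintype.card_fin]
    refine mul_le_mul_of_nonneg_left (Real.exp_le_exp.2 ?_) (by positivity)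
    have : (n : ℝ) * (Real.exp (-(ε * c / 16 * L)) * (Real.exp 1 - 1)) ≤ n * (φ ^ 2 / 160) := by
      gcongr
    linarith

lemma exists_step_factor_rpow_lt {γ : ℝ} (hγ : 1 < γ) :
    ∃ ξ : ℝ, 0 < ξ ∧ ξ ≤ 1 / 2 ∧
      2 * (1 - (1 - 2 * ξ) * (1 - ξ) ^ 2 / (2 * (1 + ξ))) ^ γ < 1 := by
  have hcont : ContinuousAt
      (fun ξ : ℝ => 2 * (1 - (1 - 2 * ξ) * (1 - ξ) ^ 2 / (2 * (1 + ξ))) ^ γ) 0 := by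
    refine continuousAt_const.mul (ContinuousAt.rpow_const ?_ (Or.inl (by norm_num)))
    refine continuousAt_const.sub (ContinuousAt.div ?_ ?_ (by norm_num)) <;> fun_prop
  have h0 : 2 * (1 - (1 - 2 * (0 : ℝ)) * (1 - 0) ^ 2 / (2 * (1 + 0))) ^ γ < 1 := by
    have := Real.rpow_lt_rpow_of_exponent_gt (x := 1 / 2) (by norm_num) (by norm_num) hγ
    rw [Real.rpow_one] at this
    norm_num at this ⊢
    linarith
  have h1 := hcont.eventually (gt_mem_nhds h0)
  obtain ⟨ξ, h, hξ⟩ := ((h1.filter_mono nhdsWithin_le_nhds).and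
    (Ioo_mem_nhdsGT (show (0 : ℝ) < 1 / 2 by norm_num))).exists
  exact ⟨ξ, hξ.1, hξ.2.le, h⟩

/-- With high probability, random lists of the sizes in question admit a proper colouring. -/
lemma eventually_sum_no_listColouring_le {ε η δ : ℝ} (hε : 0 < ε) (hη : 0 < η) (hδ : 0 < δ) :
    ∀ᶠ n : ℕ in Filter.atTop, (1 + η) * (2 * Real.log n / ((1 + ε) * n)) ∈ Set.Icc (0 : ℝ) 1 ∧
      ∀ q m : ℕ, (1 + ε / 2) * n ≤ q → ε / 4 * n ≤ m → (1 + ε) * n ≤ q + m →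
      ∑ S : Fin n × Fin n → Fin q ⊕ Fin m → Bool,
        piWt (fun _ => listWt ((1 + η) * (2 * Real.log n / ((1 + ε) * n)))) S *
          (if HasListColouring S then 0 else 1) ≤ δ := by
  obtain ⟨ξ, hξ, hξ₁, hs⟩ := exists_step_factor_rpow_lt (γ := 1 + ε / 2) (by linarith)
  set ρ := 1 - (1 - 2 * ξ) * (1 - ξ) ^ 2 / (2 * (1 + ξ)) with hρ
  have hρ₀ : 0 ≤ ρ := step_factor_nonneg hξ hξ₁
  have hρ₁ : ρ ≤ 1 := by
    have : 0 ≤ (1 - 2 * ξ) * (1 - ξ) ^ 2 / (2 * (1 + ξ)) :=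
      div_nonneg (mul_nonneg (by linarith) (sq_nonneg _)) (by linarith)
    linarith
  have hs₀ : 0 ≤ 2 * ρ ^ (1 + ε / 2) := by positivity
  set c := 2 * (1 + η) / (1 + ε) with hc_def
  have hc : 0 < c := by positivity
  have hcε : c * (1 + ε) = 2 * (1 + η) := by
    rw [hc_def]
    field_simp
  set lam := Real.log (2 * (1 + η) / η) with hlam_def
  have hlam : 0 < lam := Real.log_pos (by rw [lt_div_iff₀ hη]; linarith)
  have hlamη : 1 + η / 2 ≤ (1 + η) * (1 - Real.exp (-lam)) := by
    rw [Real.exp_neg, hlam_def, Real.exp_log (by positivity)]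
    apply le_of_eq
    field_simp
    ring
  set a₀ := min (η / (4 * lam)) (min (ε * c / 16) (c / 4)) with ha_def
  have ha₀ : 0 < a₀ := by positivity
  have ha₁ : 4 * lam * a₀ ≤ η := by
    have : a₀ ≤ η / (4 * lam) := min_le_left _ _
    rw [le_div_iff₀ (by positivity)] at this
    linarith
  have ha₂ : a₀ ≤ ε * c / 16 := (min_le_right _ _).trans (min_le_left _ _)
  have ha₃ : a₀ ≤ c / 4 := (min_le_right _ _).trans (min_le_right _ _)
  set t := 4 / a₀ with ht_def
  have ht : 0 < t := by positivity
  have hta : t * a₀ = 4 := div_mul_cancel₀ _ ha₀.ne'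
  have het : 0 < Real.exp t - 1 := by linarith [Real.add_one_lt_exp ht.ne']
  set φ := min 1 (1 / (c * (Real.exp t - 1))) with hφ_def
  have hφ₀ : 0 < φ := by positivity
  have hφ₁ : φ ≤ 1 := min_le_left _ _
  have hφ : φ * (c * (Real.exp t - 1)) ≤ 1 :=
    (le_div_iff₀ (by positivity)).1 (min_le_right _ _)
  have hN : Filter.Tendsto (fun n : ℕ => (n : ℝ)) Filter.atTop Filter.atTop :=
    tendsto_natCast_atTop_atTop
  have hL : Filter.Tendsto (fun n : ℕ => Real.log n) Filter.atTop Filter.atTop :=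
    Real.tendsto_log_atTop.comp hN
  have hdecay : ∀ {f : ℕ → ℝ} (x : ℝ), 0 < x → Filter.Tendsto f Filter.atTop Filter.atTop →
      Filter.Tendsto (fun n => Real.exp (-(x * f n))) Filter.atTop (nhds 0) := fun x hx hf =>
    Real.tendsto_exp_neg_atTop_nhds_zero.comp (hf.const_mul_atTop hx)
  have g₁ := (hdecay (ε * c / 16) (by positivity) hL).eventually_le_const
    (show (0 : ℝ) < 1 / 2 by norm_num)
  have g₂ := (hdecay (c / 4) (by positivity) hL).eventually_le_const
    (show (0 : ℝ) < 1 / 2 by norm_num)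
  have g₃ : ∀ᶠ n : ℕ in Filter.atTop,
      Real.exp (-(ε * c / 16 * Real.log n)) * (Real.exp 1 - 1) ≤ φ ^ 2 / 160 :=
    Filter.Tendsto.eventually_le_const (by positivity)
      (by simpa using (hdecay (ε * c / 16) (by positivity) hL).mul_const (Real.exp 1 - 1))
  have g₄ := (hN.const_mul_atTop hφ₀).eventually_ge_atTop 100
  have g₅ : ∀ᶠ n : ℕ in Filter.atTop,
      Real.exp (ξ / 2 - ξ ^ 2 / 4 * (φ / 16 * (c * Real.log n))) ≤ ξ := by
    have h := (hdecay (ξ ^ 2 / 4 * (φ / 16 * c)) (by positivity) hL).const_mul (Real.exp (ξ / 2))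
    rw [mul_zero] at h
    filter_upwards [h.eventually_le_const hξ] with n hn
    refine le_trans (le_of_eq ?_) hn
    rw [← Real.exp_add]
    ring_nf
  have g₆ : ∀ᶠ n : ℕ in Filter.atTop,
      2 * (n : ℝ) ≤ ξ * (2 : ℝ) ^ (ξ * (φ / 16 * n)) := by
    have hz : 0 < ξ * (φ / 16) := by positivity
    have h := (tendsto_self_mul_const_pow_of_lt_one (r := (2 : ℝ) ^ (-(ξ * (φ / 16))))
      (by positivity) (Real.rpow_lt_one_of_one_lt_of_neg (by norm_num) (by linarith)))
    filter_upwards [h.eventually_le_const (half_pos hξ)] with n hn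
    have h2 : ((2 : ℝ) ^ (-(ξ * (φ / 16)))) ^ n * 2 ^ (ξ * (φ / 16 * n)) = 1 := by
      rw [← Real.rpow_natCast, ← Real.rpow_mul (by norm_num), ← Real.rpow_add (by norm_num)]
      ring_nf
      simp
    have h3 := mul_le_mul_of_nonneg_right hn
      (by positivity : (0 : ℝ) ≤ 2 ^ (ξ * (φ / 16 * n)))
    rw [mul_assoc, h2] at h3
    linarith
  have k₁ := (hdecay (η / 2) (by positivity) hL).eventually_le_const
    (show 0 < δ / 5 by positivity)
  have k₂ : ∀ᶠ n : ℕ in Filter.atTop,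
      2 * (n : ℝ) * Real.exp (-(φ ^ 2 / 160 * n)) ≤ δ / 5 := by
    have h := (tendsto_self_mul_const_pow_of_lt_one (r := Real.exp (-(φ ^ 2 / 160)))
      (Real.exp_pos _).le (Real.exp_lt_one_iff.2 (by linarith [pow_pos hφ₀ 2])))
    filter_upwards [h.eventually_le_const (show 0 < δ / 10 by positivity)] with n hn
    rw [← Real.exp_nat_mul] at hn
    rw [show -(φ ^ 2 / 160 * n) = (n : ℝ) * -(φ ^ 2 / 160) by ring]
    linarith
  have k₃ : ∀ᶠ n : ℕ in Filter.atTop,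
      2 * ((n : ℝ) * (2 * ρ ^ (1 + ε / 2)) ^ n) ≤ δ / 5 :=
    Filter.Tendsto.eventually_le_const (by positivity)
      (by simpa using (tendsto_self_mul_const_pow_of_lt_one hs₀ hs).const_mul 2)
  have k₄ := (hdecay 1 one_pos hL).eventually_le_const (show 0 < δ / 10 by positivity)
  have g₇ : ∀ᶠ n : ℕ in Filter.atTop, c * Real.log n ≤ n := by
    have h := (Real.isLittleO_log_id_atTop.comp_tendsto hN).bound (inv_pos.2 hc)
    filter_upwards [h] with n hn
    simp only [Function.comp_apply, id_eq, Real.norm_eq_abs, Nat.abs_cast] at hn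
    have := mul_le_mul_of_nonneg_left ((le_abs_self _).trans hn) hc.le
    rwa [mul_inv_cancel_left₀ hc.ne'] at this
  filter_upwards [g₁, g₂, g₃, g₄, g₅, g₆, g₇, k₁, k₂, k₃, k₄, hL.eventually_gt_atTop 0,
    Filter.eventually_gt_atTop 0] with n g₁ g₂ g₃ g₄ g₅ g₆ g₇ k₁ k₂ k₃ k₄ hLn hn0
  have hn : (0 : ℝ) < n := by exact_mod_cast hn0
  have hp : (1 + η) * (2 * Real.log n / ((1 + ε) * n)) = c * Real.log n / n := by
    rw [hc_def]
    field_simp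
  rw [hp]
  have hp₁ : c * Real.log n / n ≤ 1 := (div_le_one hn).2 g₇
  refine ⟨⟨by positivity, hp₁⟩, fun q m hq hm hqm => ?_⟩
  have hnq : n ≤ q := by
    have : (n : ℝ) ≤ q := by nlinarith
    exact_mod_cast this
  refine (sum_no_listColouring_le_of_parameters hc hcε hlam hlamη ha₁ ha₂ ha₃ ht.le hta hφ₀ hφ₁
    hφ hξ hξ₁ (Real.exp_log hn) hLn (div_mul_cancel₀ _ hn.ne') hp₁ hnq hm hqm g₁ g₂ g₃ g₄ g₅
    g₆).trans ?_
  have k₅ : ρ ^ q * (2 * n * 2 ^ n) ≤ 2 * (n * (2 * ρ ^ (1 + ε / 2)) ^ n) := by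
    have h : ρ ^ q ≤ (ρ ^ (1 + ε / 2)) ^ n := by
      rw [← Real.rpow_natCast, ← Real.rpow_natCast, ← Real.rpow_mul hρ₀]
      exact Real.rpow_le_rpow_of_exponent_ge' hρ₀ hρ₁ (by positivity) hq
    calc ρ ^ q * (2 * n * 2 ^ n) ≤ (ρ ^ (1 + ε / 2)) ^ n * (2 * n * 2 ^ n) := by gcongr
      _ = _ := by
        rw [mul_pow]
        ring
  rw [one_mul] at k₄
  linarith

/-! ### Random arrays as random lists -/

lemma arrProb_eq_sum_listWt (m n k : ℕ) (p : ℝ) (P : (Fin m → Fin n → Fin k → Bool) → Prop) :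
    arrProb m n k p P = ∑ S : Fin m × Fin n → Fin k → Bool, piWt (fun _ => listWt p) S *
      (if P fun i j => S (i, j) then 1 else 0) := by
  refine Fintype.sum_equiv (Equiv.curry (Fin m) (Fin n) (Fin k → Bool)).symm _ _ fun M => ?_
  have h : piWt (fun _ => listWt p) ((Equiv.curry (Fin m) (Fin n) (Fin k → Bool)).symm M)
      = ∏ i, ∏ j, ∏ c, (if M i j c = true then p else 1 - p) := by
    unfold piWt
    rw [Fintype.prod_prod_type]
    rfl
  rw [h, mul_ite, mul_one, mul_zero]
  rfl

lemma sum_listWt_eq_sum_bern {X C : Type*} [Fintype X] [DecidableEq X] [Fintype C] [DecidableEq C]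
    (p : ℝ) (F : (X → C → Bool) → ℝ) :
    ∑ S : X → C → Bool, piWt (fun _ => listWt p) S * F S
      = ∑ S : X × C → Bool, piWt (fun _ => bern p) S * F fun x c => S (x, c) := by
  refine Fintype.sum_equiv (Equiv.curry X C Bool).symm _ _ fun S => ?_
  congr 1
  unfold piWt
  rw [Fintype.prod_prod_type]
  rfl

lemma sum_listWt_congr {X C C' : Type*} [Fintype X] [DecidableEq X] [Fintype C] [DecidableEq C]
    [Fintype C'] [DecidableEq C'] (e : C ≃ C') (p : ℝ) (F : (X → C → Bool) → ℝ) :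
    ∑ S : X → C → Bool, piWt (fun _ => listWt p) S * F S
      = ∑ S : X → C' → Bool, piWt (fun _ => listWt p) S * F fun x c => S x (e c) := by
  refine Fintype.sum_equiv (Equiv.arrowCongr (Equiv.refl X) (Equiv.arrowCongr e (Equiv.refl Bool)))
    _ _ fun S => ?_
  congr 1
  · unfold piWt listWt piWt
    refine Finset.prod_congr rfl fun x _ => ?_
    refine Fintype.prod_equiv e _ _ fun c => ?_
    simp [Equiv.arrowCongr]
  · congr 1
    funext x c
    simp [Equiv.arrowCongr]

lemma ContainsLatinBox.mono {m n k : ℕ} {M M' : Fin m → Fin n → Fin k → Bool}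
    (h : ∀ i j c, M i j c = true → M' i j c = true) (hM : ContainsLatinBox M) :
    ContainsLatinBox M' := by
  obtain ⟨L, hL, hLM⟩ := hM
  exact ⟨L, hL, fun i j c hc => h i j c (hLM i j c hc)⟩

lemma arrProb_containsLatinBox_mono (m n k : ℕ) {p q : ℝ} (hp : p ∈ Set.Icc (0 : ℝ) 1)
    (hq : q ∈ Set.Icc (0 : ℝ) 1) (hpq : p ≤ q) :
    arrProb m n k p ContainsLatinBox ≤ arrProb m n k q ContainsLatinBox := by
  rw [arrProb_eq_sum_listWt, arrProb_eq_sum_listWt,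
    sum_listWt_eq_sum_bern p fun S => if ContainsLatinBox fun i j => S (i, j) then 1 else 0,
    sum_listWt_eq_sum_bern q fun S => if ContainsLatinBox fun i j => S (i, j) then 1 else 0]
  refine sum_piWt_bern_mono hp hq hpq _ fun S T hST => ?_
  by_cases h : ContainsLatinBox fun i j => fun c => S ((i, j), c)
  · rw [if_pos h, if_pos (h.mono fun i j c hc => hST _ hc)]
  · rw [if_neg h]
    split_ifs <;> norm_num

lemma arrProb_nonneg (m n k : ℕ) {p : ℝ} (hp : p ∈ Set.Icc (0 : ℝ) 1)
    (P : (Fin m → Fin n → Fin k → Bool) → Prop) : 0 ≤ arrProb m n k p P := by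
  rw [arrProb_eq_sum_listWt]
  refine Finset.sum_nonneg fun S _ => mul_nonneg (piWt_nonneg (fun _ => listWt_nonneg hp) S) ?_
  split_ifs <;> norm_num

lemma arrProb_le_one (m n k : ℕ) {p : ℝ} (hp : p ∈ Set.Icc (0 : ℝ) 1)
    (P : (Fin m → Fin n → Fin k → Bool) → Prop) : arrProb m n k p P ≤ 1 := by
  rw [arrProb_eq_sum_listWt]
  refine le_trans (Finset.sum_le_sum fun S _ => ?_)
    (sum_piWt_eq_one (X := Fin m × Fin n) fun _ => sum_listWt (C := Fin k) p).le
  refine mul_le_of_le_one_right (piWt_nonneg (fun _ => listWt_nonneg hp) S) ?_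
  split_ifs <;> norm_num

lemma numOnes_eq_sum {m n k : ℕ} (L : Fin m → Fin n → Fin k → Bool) :
    numOnes L = ∑ x : Fin m × Fin n, (Finset.univ.filter fun c => L x.1 x.2 c = true).card := by
  unfold numOnes
  simp only [Finset.card_filter, Fintype.sum_prod_type]

lemma HasListColouring.containsLatinBox {n k : ℕ} {S : Fin n × Fin n → Fin k → Bool}
    (h : HasListColouring S) : ContainsLatinBox fun i j => S (i, j) := by
  obtain ⟨F, hF, hS⟩ := h
  refine ⟨fun i j c => decide (F (i, j) = c), ⟨?_, fun i j => ?_, fun i c => ?_, fun j c => ?_⟩,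
    fun i j c hc => ?_⟩
  · rw [numOnes_eq_sum]
    simp [Finset.filter_eq]
  · simp [Finset.filter_eq]
  · refine Finset.card_le_one.2 fun j hj j' hj' => ?_
    simp only [decide_eq_true_eq, Finset.mem_filter, Finset.mem_univ, true_and] at hj hj'
    exact congrArg Prod.snd (hF (Sum.inl i) (i, j) (i, j') rfl rfl (hj.trans hj'.symm))
  · refine Finset.card_le_one.2 fun i hi i' hi' => ?_
    simp only [decide_eq_true_eq, Finset.mem_filter, Finset.mem_univ, true_and] at hi hi'
    exact congrArg Prod.fst (hF (Sum.inr j) (i, j) (i', j) rfl rfl (hi.trans hi'.symm))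
  · simp only [decide_eq_true_eq] at hc
    exact hc ▸ hS (i, j)

lemma HasListColouring.comp_equiv {V C C' : Type*} {S : V × V → C' → Bool} (e : C ≃ C')
    (h : HasListColouring fun x c => S x (e c)) : HasListColouring S := by
  obtain ⟨F, hF, hS⟩ := h
  exact ⟨fun x => e (F x), fun l x y hx hy hxy => hF l x y hx hy (e.injective hxy), hS⟩

/-- The probability of containing a Latin box in terms of list colourings. -/
lemma one_sub_le_arrProb {n q m k : ℕ} (hk : q + m = k) {p : ℝ} (hp : p ∈ Set.Icc (0 : ℝ) 1) :
    1 - ∑ S : Fin n × Fin n → Fin q ⊕ Fin m → Bool, piWt (fun _ => listWt p) S *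
      (if HasListColouring S then 0 else 1) ≤ arrProb n n k p ContainsLatinBox := by
  subst hk
  rw [arrProb_eq_sum_listWt, sum_listWt_congr finSumFinEquiv p
    fun S : Fin n × Fin n → Fin q ⊕ Fin m → Bool => if HasListColouring S then 0 else 1,
    sub_le_iff_le_add, ← Finset.sum_add_distrib]
  refine (sum_piWt_eq_one (X := Fin n × Fin n) fun _ => sum_listWt (C := Fin (q + m)) p).symm.le.trans
    (Finset.sum_le_sum fun S _ => ?_)
  rw [← mul_add]
  refine le_mul_of_one_le_right (piWt_nonneg (fun _ => listWt_nonneg hp) S) ?_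
  by_cases h : HasListColouring fun x c => S x (finSumFinEquiv c)
  · rw [if_pos h, if_pos (h.comp_equiv finSumFinEquiv).containsLatinBox, add_zero]
  · rw [if_neg h]
    split_ifs <;> norm_num

lemma ContainsLatinBox.exists_true {m n k : ℕ} {M : Fin m → Fin n → Fin k → Bool}
    (h : ContainsLatinBox M) (i : Fin m) (j : Fin n) : ∃ c, M i j c = true := by
  obtain ⟨L, ⟨hcard, hij, -, -⟩, hLM⟩ := h
  rw [numOnes_eq_sum] at hcard
  by_contra! hcon
  have hlt : ∑ x : Fin m × Fin n, (Finset.univ.filter fun c => L x.1 x.2 c = true).card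
      < ∑ _x : Fin m × Fin n, 1 := by
    refine Finset.sum_lt_sum (fun x _ => hij x.1 x.2) ⟨(i, j), Finset.mem_univ _, ?_⟩
    rw [Nat.lt_one_iff, Finset.card_eq_zero, Finset.filter_eq_empty_iff]
    exact fun c _ hc => hcon c (hLM i j c hc)
  rw [hcard, Finset.sum_const, Finset.card_univ, Fintype.card_prod, Fintype.card_fin,
    Fintype.card_fin, smul_eq_mul, mul_one] at hlt
  exact lt_irrefl _ hlt

lemma sum_listWt_exists_true {C : Type*} [Fintype C] [DecidableEq C]
    [DecidablePred fun s : C → Bool => ∃ c, s c = true] (p : ℝ) :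
    ∑ s : C → Bool, listWt p s * (if ∃ c, s c = true then 1 else 0)
      = 1 - (1 - p) ^ Fintype.card C := by
  have h : ∀ s : C → Bool, listWt p s * (if ∃ c, s c = true then 1 else 0)
      = listWt p s - if s = fun _ => false then (1 - p) ^ Fintype.card C else 0 := by
    intro s
    by_cases hs : ∃ c, s c = true
    · have : s ≠ fun _ => false := by
        rintro rfl
        simp at hs
      rw [if_pos hs, if_neg this, mul_one, sub_zero]
    · have : s = fun _ => false := by
        funext c
        simpa using fun hc => hs ⟨c, hc⟩
      rw [if_neg hs, if_pos this, this]
      simp [listWt, piWt, bern]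
  rw [Finset.sum_congr rfl fun s _ => h s, Finset.sum_sub_distrib, sum_listWt,
    Finset.sum_ite_eq' Finset.univ (fun _ : C => false), if_pos (Finset.mem_univ _)]

lemma arrProb_containsLatinBox_le (m n k : ℕ) {p : ℝ} (hp : p ∈ Set.Icc (0 : ℝ) 1) :
    arrProb m n k p ContainsLatinBox ≤ Real.exp (-(m * n * (1 - p) ^ k)) := by
  have hprod : ∀ S : Fin m × Fin n → Fin k → Bool, piWt (fun _ => listWt p) S *
      (if ContainsLatinBox fun i j => S (i, j) then 1 else 0)
      ≤ piWt (fun _ s => listWt p s * if ∃ c, s c = true then 1 else 0) S := by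
    intro S
    have hw : ∀ (_ : Fin m × Fin n) (s : Fin k → Bool),
        0 ≤ listWt p s * if ∃ c, s c = true then 1 else 0 := fun _ s =>
      mul_nonneg (listWt_nonneg hp s) (by split_ifs <;> norm_num)
    by_cases h : ContainsLatinBox fun i j => S (i, j)
    · rw [if_pos h, mul_one]
      refine le_of_eq (Finset.prod_congr rfl fun x _ => ?_)
      have hx : ∃ c, S x c = true := h.exists_true x.1 x.2
      simp only [hx, if_true, mul_one]
    · rw [if_neg h, mul_zero]
      exact piWt_nonneg hw S
  rw [arrProb_eq_sum_listWt]
  refine (Finset.sum_le_sum fun S _ => hprod S).trans ?_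
  rw [sum_piWt, Finset.prod_congr rfl fun _ _ => sum_listWt_exists_true p, Finset.prod_const,
    Finset.card_univ, Fintype.card_prod, Fintype.card_fin, Fintype.card_fin, Fintype.card_fin]
  have h0 : 0 ≤ 1 - (1 - p) ^ k := by
    rw [sub_nonneg]
    exact pow_le_one₀ (by linarith [hp.2]) (by linarith [hp.1])
  refine (pow_le_pow_left₀ h0 (Real.one_sub_le_exp_neg _) (m * n)).trans (le_of_eq ?_)
  rw [← Real.exp_nat_mul]
  push_cast
  ring_nf

/-- Below the threshold. -/
lemma tendsto_arrProb_zero {ε η : ℝ} (hε : 0 < ε) (hη : 0 < η) (hη₁ : η ≤ 1 / 2) :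
    Filter.Tendsto (fun n : ℕ => arrProb n n ⌈(1 + ε) * (n : ℝ)⌉₊
      ((1 - η) * (2 * Real.log n / ((1 + ε) * n))) ContainsLatinBox) Filter.atTop (nhds 0) := by
  have hN : Filter.Tendsto (fun n : ℕ => (n : ℝ)) Filter.atTop Filter.atTop :=
    tendsto_natCast_atTop_atTop
  have hL : Filter.Tendsto (fun n : ℕ => Real.log n) Filter.atTop Filter.atTop :=
    Real.tendsto_log_atTop.comp hN
  have hlim : Filter.Tendsto (fun n : ℕ => Real.exp (-Real.exp (2 * η ^ 2 * Real.log n - 2)))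
      Filter.atTop (nhds 0) := by
    refine Real.tendsto_exp_neg_atTop_nhds_zero.comp (Real.tendsto_exp_atTop.comp ?_)
    exact Filter.tendsto_atTop_add_const_right _ _ (hL.const_mul_atTop (by positivity))
  have hlog : ∀ᶠ n : ℕ in Filter.atTop, Real.log n ≤ η / 4 * n := by
    have h := (Real.isLittleO_log_id_atTop.comp_tendsto hN).bound
      (show 0 < η / 4 by positivity)
    filter_upwards [h] with n hn
    simp only [Function.comp_apply, id_eq, Real.norm_eq_abs, Nat.abs_cast] at hn
    exact (le_abs_self _).trans hn
  have hbounds : ∀ᶠ n : ℕ in Filter.atTop,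
      0 ≤ arrProb n n ⌈(1 + ε) * (n : ℝ)⌉₊ ((1 - η) * (2 * Real.log n / ((1 + ε) * n)))
        ContainsLatinBox ∧
      arrProb n n ⌈(1 + ε) * (n : ℝ)⌉₊ ((1 - η) * (2 * Real.log n / ((1 + ε) * n)))
        ContainsLatinBox ≤ Real.exp (-Real.exp (2 * η ^ 2 * Real.log n - 2)) := by
    filter_upwards [hlog, hL.eventually_gt_atTop 0, Filter.eventually_gt_atTop 0]
      with n hlog hLn hn0
    have hn : (0 : ℝ) < n := by exact_mod_cast hn0
    set p := (1 - η) * (2 * Real.log n / ((1 + ε) * n)) with hp_def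
    have hpn : p * ((1 + ε) * n) = 2 * (1 - η) * Real.log n := by
      rw [hp_def]
      field_simp
    have hp₀ : 0 ≤ p := mul_nonneg (by linarith) (by positivity)
    have hpη : p ≤ η / 2 := by
      refine le_of_mul_le_mul_right (a := (1 + ε) * (n : ℝ)) ?_ (by positivity)
      rw [hpn]
      have h1 : 2 * (1 - η) * Real.log n ≤ 2 * 1 * Real.log n := by
        gcongr
        linarith
      have h2 : η / 2 * (1 * n) ≤ η / 2 * ((1 + ε) * n) := by
        gcongr
        linarith
      linarith
    have hp : p ∈ Set.Icc (0 : ℝ) 1 := ⟨hp₀, by linarith⟩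
    refine ⟨arrProb_nonneg _ _ _ hp _, (arrProb_containsLatinBox_le _ _ _ hp).trans
      (Real.exp_le_exp.2 (neg_le_neg ?_))⟩
    have h1p : Real.exp (-((1 + η) * p)) ≤ 1 - p := by
      rw [Real.exp_neg, inv_le_comm₀ (Real.exp_pos _) (by linarith)]
      refine le_trans ?_ (Real.add_one_le_exp _)
      rw [inv_le_iff_one_le_mul₀ (by linarith)]
      have h1 : (1 + η) * p ≤ 2 * (η / 2) := by
        gcongr
        linarith
      nlinarith [mul_le_mul_of_nonneg_left h1 hp₀]
    set k := ⌈(1 + ε) * (n : ℝ)⌉₊ with hk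
    have hk1 : (k : ℝ) ≤ (1 + ε) * n + 1 := (Nat.ceil_lt_add_one (by positivity)).le
    have hpow : Real.exp (-(k * ((1 + η) * p))) ≤ (1 - p) ^ k := by
      rw [← mul_neg, Real.exp_nat_mul]
      exact pow_le_pow_left₀ (Real.exp_pos _).le h1p k
    calc Real.exp (2 * η ^ 2 * Real.log n - 2)
        ≤ Real.exp (Real.log n + Real.log n + -(k * ((1 + η) * p))) := by
          refine Real.exp_le_exp.2 ?_
          have h1 : (k : ℝ) * ((1 + η) * p) ≤ ((1 + ε) * n + 1) * ((1 + η) * p) := by gcongr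
          have h2 : ((1 + ε) * n + 1) * ((1 + η) * p)
              = (1 + η) * (2 * (1 - η) * Real.log n) + (1 + η) * p := by
            rw [← hpn]
            ring
          have h3 : (1 + η) * p ≤ 2 * 1 := by gcongr <;> linarith
          nlinarith
      _ = n * n * Real.exp (-(k * ((1 + η) * p))) := by
          rw [Real.exp_add, Real.exp_add, Real.exp_log hn]
      _ ≤ n * n * (1 - p) ^ k := by gcongr
  exact tendsto_of_tendsto_of_tendsto_of_le_of_le' tendsto_const_nhds hlim
    (hbounds.mono fun _ h => h.1) (hbounds.mono fun _ h => h.2)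

/-- Above the threshold. -/
lemma tendsto_arrProb_one {ε η : ℝ} (hε : 0 < ε) (hη : 0 < η) :
    Filter.Tendsto (fun n : ℕ => arrProb n n ⌈(1 + ε) * (n : ℝ)⌉₊
      ((1 + η) * (2 * Real.log n / ((1 + ε) * n))) ContainsLatinBox) Filter.atTop (nhds 1) := by
  rw [Metric.tendsto_atTop']
  intro δ hδ
  have hev : ∀ᶠ n : ℕ in Filter.atTop, dist (arrProb n n ⌈(1 + ε) * (n : ℝ)⌉₊
      ((1 + η) * (2 * Real.log n / ((1 + ε) * n))) ContainsLatinBox) 1 < δ := by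
    have hlarge := (tendsto_natCast_atTop_atTop (R := ℝ)).eventually_ge_atTop (4 / ε)
    filter_upwards [eventually_sum_no_listColouring_le hε hη (half_pos hδ), hlarge] with n h hn
    obtain ⟨hp, h⟩ := h
    rw [div_le_iff₀ hε] at hn
    have hle : ⌈(1 + ε / 2) * (n : ℝ)⌉₊ ≤ ⌈(1 + ε) * (n : ℝ)⌉₊ := by
      refine Nat.ceil_le_ceil ?_
      gcongr
      linarith
    have hsub := Nat.add_sub_cancel' hle
    have hq := Nat.le_ceil ((1 + ε / 2) * (n : ℝ))
    have hq' := Nat.ceil_lt_add_one (a := (1 + ε / 2) * (n : ℝ)) (by positivity)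
    have hk := Nat.le_ceil ((1 + ε) * (n : ℝ))
    have hsub' : (⌈(1 + ε / 2) * (n : ℝ)⌉₊ : ℝ)
        + (⌈(1 + ε) * (n : ℝ)⌉₊ - ⌈(1 + ε / 2) * (n : ℝ)⌉₊ : ℕ) = ⌈(1 + ε) * (n : ℝ)⌉₊ := by
      exact_mod_cast hsub
    have hlow := one_sub_le_arrProb (n := n) hsub hp
    have := h _ (⌈(1 + ε) * (n : ℝ)⌉₊ - ⌈(1 + ε / 2) * (n : ℝ)⌉₊) hq (by linarith) (by linarith)
    rw [Real.dist_eq, abs_lt]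
    constructor <;> linarith [arrProb_le_one n n ⌈(1 + ε) * (n : ℝ)⌉₊ hp ContainsLatinBox]
  obtain ⟨N, hN⟩ := Filter.eventually_atTop.1 hev
  exact ⟨N, fun n hn => hN n hn.le⟩

/-- For `ε > 0` and `k = ⌈(1+ε)n⌉`, `p₀ = 2·log n/((1+ε)n)` is a sharp threshold for
`M ~ M(n,n,k;p)` to contain a Latin box: for every `η > 0`, if eventually
`p ≤ (1−η)p₀` the probability tends to `0`, and if eventually `p ≥ (1+η)p₀` it tends to `1`. -/
theorem stmt6 (ε : ℝ) (hε : 0 < ε) (p : ℕ → ℝ) (hp : ∀ n, p n ∈ Set.Icc (0 : ℝ) 1)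
    (η : ℝ) (hη : 0 < η) :
    ((∀ᶠ n : ℕ in Filter.atTop, p n ≤ (1 - η) * (2 * Real.log n / ((1 + ε) * n))) →
      Filter.Tendsto (fun n : ℕ =>
          arrProb n n ⌈(1 + ε) * (n : ℝ)⌉₊ (p n) ContainsLatinBox)
        Filter.atTop (nhds 0)) ∧
    ((∀ᶠ n : ℕ in Filter.atTop, (1 + η) * (2 * Real.log n / ((1 + ε) * n)) ≤ p n) →
      Filter.Tendsto (fun n : ℕ =>
          arrProb n n ⌈(1 + ε) * (n : ℝ)⌉₊ (p n) ContainsLatinBox)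
        Filter.atTop (nhds 1)) := by
  constructor
  · intro hle
    have hη₁ : 0 < min η (1 / 2) := by positivity
    have hlim := tendsto_arrProb_zero hε hη₁ (min_le_right _ _)
    refine tendsto_of_tendsto_of_tendsto_of_le_of_le' tendsto_const_nhds hlim
      (Filter.Eventually.of_forall fun n => arrProb_nonneg _ _ _ (hp n) _) ?_
    have hone : ∀ᶠ n : ℕ in Filter.atTop,
        (1 + 1) * (2 * Real.log n / ((1 + ε) * n)) ∈ Set.Icc (0 : ℝ) 1 :=
      (eventually_sum_no_listColouring_le hε one_pos one_pos).mono fun _ h => h.1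
    filter_upwards [hle, hone] with n hn hn₁
    have hp₀ : 0 ≤ 2 * Real.log n / ((1 + ε) * n) := by linarith [hn₁.1]
    have hη₂ : min η (1 / 2) ≤ 1 / 2 := min_le_right _ _
    refine arrProb_containsLatinBox_mono _ _ _ (hp n)
      ⟨mul_nonneg (by linarith) hp₀, ?_⟩ (hn.trans ?_)
    · refine le_trans ?_ hn₁.2
      gcongr
      linarith
    · gcongr
      exact min_le_left _ _
  · intro hle
    have hlim := tendsto_arrProb_one hε hη
    refine tendsto_of_tendsto_of_tendsto_of_le_of_le' hlim tendsto_const_nhds ?_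
      (Filter.Eventually.of_forall fun n => arrProb_le_one _ _ _ (hp n) _)
    filter_upwards [hle, eventually_sum_no_listColouring_le hε hη one_pos] with n hn hn₁
    exact arrProb_containsLatinBox_mono _ _ _ hn₁.1 (hp n) hn

end
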